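/- Let G be a finite simple graph on a finite vertex set V, and let pos : V → ℂ be a straight-line planar drawing of G, i.e.: pos is injective; for every edge {a,b} of G and every vertex u ∉ {a,b}, pos u does not lie on the closed segment [pos a, pos b]; and for any two distinct edges {a,b} and {c,d} of G, the intersection of the closed segments [pos a, pos b] and [pos c, pos d] is contained in {pos u : u ∈ {a,b} ∩ {c,d}}. An oriented edge is an ordered pair e = (u,v) with u adjacent to v; its tail is u, its head is v, its underlying edge is {u,v}, and its reversal is (v,u). For oriented edges e = (u,v) and e' = (v,w) with w ≠ u, let α(e,e') = arg((pos w − pos v)/(pos v − pos u)) ∈ (−π,π]. Let M be the square matrix over the multivariate polynomial ring ℂ[X_f : f ∈ edgeSet G], indexed by oriented edges, with entries: M_{e,e'} = 1 if e' = e; M_{e,e'} = −exp((i/2)·α(e,e'))·X_{{u,v}} if the tail of e' equals the head v of e = (u,v) and e' is not the reversal of e; and M_{e,e'} = 0 otherwise. Then det M = (Σ_ξ Π_{f∈ξ} X_f)², where ξ ranges over all even subsets of edgeSet G, i.e. subsets such that every vertex of G is contained in an even number of edges of ξ. (This is the classical Kac–Ward formula, the genus-zero case of the paper's Theorem 1.)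 -/

import Mathlib

open scoped BigOperators

/-- The sign of the pair `(a, b)`: it is `-1` when `b < a` and `1` otherwise. -/
def ordSign (R : Type*) [Ring R] {H : Type*} [LinearOrder H] (a b : H) : R :=
  if b < a then -1 else 1

section OrdSign

variable {R : Type*} [CommRing R] {H : Type*} [LinearOrder H]

theorem ordSign_self (a : H) : ordSign R a a = 1 := by simp [ordSign]

theorem ordSign_mul_self (a b : H) : ordSign R a b * ordSign R a b = 1 := by
  unfold ordSign; split_ifs <;> simp

theorem ordSign_swap {a b : H} (h : a ≠ b) : ordSign R b a = -ordSign R a b := by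
  unfold ordSign
  rcases lt_or_gt_of_ne h with h | h <;> simp [h, h.not_gt]

/-- The sign of the number of elements of `S` above `a`. -/
def rankSign (R : Type*) [CommRing R] {H : Type*} [LinearOrder H] (S : Finset H) (a : H) : R :=
  ∏ s ∈ S, ordSign R s a

theorem rankSign_mul_self (S : Finset H) (a : H) : rankSign R S a * rankSign R S a = 1 := by
  rw [rankSign, ← Finset.prod_mul_distrib]
  exact Finset.prod_eq_one fun s _ => ordSign_mul_self s a

theorem rankSign_insert {S : Finset H} {a : H} (h : a ∉ S) (b : H) :
    rankSign R (insert a S) b = ordSign R a b * rankSign R S b := by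
  rw [rankSign, Finset.prod_insert h, rankSign]

theorem rankSign_erase {S : Finset H} {a : H} (h : a ∈ S) (b : H) :
    rankSign R (S.erase a) b = ordSign R a b * rankSign R S b := by
  conv_rhs => rw [← Finset.insert_erase h, rankSign_insert (Finset.notMem_erase a S), ← mul_assoc,
    ordSign_mul_self, one_mul]

theorem sum_rankSign (B : Finset H) :
    ∑ k ∈ B, rankSign R B k = if Even B.card then 0 else 1 := by
  induction B using Finset.induction_on_max with
  | empty => simp
  | insert m s hm ih =>
    have hms : m ∉ s := fun h => lt_irrefl _ (hm m h)
    have h1 : ∀ k ∈ s, rankSign R (insert m s) k = -rankSign R s k := by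
      intro k hk
      rw [rankSign_insert hms, ordSign, if_pos (hm k hk)]; ring
    have h2 : rankSign R (insert m s) m = 1 := by
      rw [rankSign_insert hms, ordSign_self, one_mul]
      exact Finset.prod_eq_one fun x hx => by simp [ordSign, (hm x hx).not_gt]
    rw [Finset.sum_insert hms, Finset.sum_congr rfl h1, h2, Finset.sum_neg_distrib, ih,
      Finset.card_insert_of_notMem hms]
    by_cases h : Even s.card <;> simp [h, Nat.even_add_one]

theorem rankSign_mul_rankSign {S : Finset H} {a k : H} (ha : a ∈ S) (hk : k ∈ S) (hak : a ≠ k) :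
    -(rankSign R S a * rankSign R S k) =
      ∏ s ∈ (S.erase a).erase k, ordSign R s a * ordSign R s k := by
  have hk' : k ∈ S.erase a := Finset.mem_erase.2 ⟨hak.symm, hk⟩
  rw [rankSign, rankSign, ← Finset.prod_mul_distrib, ← Finset.mul_prod_erase S _ ha,
    ← Finset.mul_prod_erase _ _ hk', ordSign_self, ordSign_self, ordSign_swap hak]
  linear_combination (∏ s ∈ (S.erase a).erase k, ordSign R s a * ordSign R s k) *
    ordSign_mul_self (R := R) a k

end OrdSign

theorem prod_eq_prod_of_invol {R : Type*} [CommRing R] {H : Type*} {ι : H → H}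
    (hι : Function.Involutive ι) (hne : ∀ h, ι h ≠ h)
    {N : Finset H} (hN : ∀ n ∈ N, ι n ∈ N) {f g : H → R}
    (hg : ∀ n ∈ N, g n * g n = 1) (hfg : ∀ n ∈ N, f n * f (ι n) * (g n * g (ι n)) = 1) :
    ∏ n ∈ N, f n = ∏ n ∈ N, g n := by
  have h1 : ∏ n ∈ N, f n * g n = 1 :=
    Finset.prod_involution (fun n _ => ι n)
      (fun n hn => by linear_combination hfg n hn)
      (fun n hn _ => hne n) (fun n hn => hN n hn) (fun n hn => hι n)
  have h2 : (∏ n ∈ N, g n) * ∏ n ∈ N, g n = 1 := by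
    rw [← Finset.prod_mul_distrib]; exact Finset.prod_eq_one hg
  rw [Finset.prod_mul_distrib] at h1
  linear_combination (∏ n ∈ N, g n) * h1 - (∏ n ∈ N, f n) * h2

section Chords

variable {R : Type*} [CommRing R] {H : Type*} [LinearOrder H]

/-- It is `-1` when the chords `{n, ι n}` and `{m, ι m}` cross with leftmost endpoint `n`, and `1`
otherwise. -/
def crossSign (R : Type*) [Ring R] {H : Type*} [LinearOrder H] (ι : H → H) (n m : H) : R :=
  if n < m ∧ m < ι n ∧ ι n < ι m then -1 else 1

/-- The sign recording whether `u` lies below the chord `{n, ι n}`, with `n` its left endpoint. -/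
def underSign (R : Type*) [Ring R] {H : Type*} [LinearOrder H] (ι : H → H) (n u : H) : R :=
  if n < u ∧ u < ι n then -1 else 1

/-- The sign of the number of crossings among chords with endpoints in `X`. -/
def crossingSign (R : Type*) [CommRing R] {H : Type*} [LinearOrder H] (ι : H → H)
    (X : Finset H) : R :=
  ∏ n ∈ X, ∏ m ∈ X, crossSign R ι n m

/-- The sign attached to the chords on `N` drawn over the remaining points `U`. -/
def chordSign (R : Type*) [CommRing R] {H : Type*} [LinearOrder H] (ι : H → H)
    (N U : Finset H) : R :=
  crossingSign R ι N * ∏ n ∈ N, ∏ u ∈ U, underSign R ι n u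

theorem crossSign_mul_self (ι : H → H) (n m : H) :
    crossSign R ι n m * crossSign R ι n m = 1 := by
  unfold crossSign; split_ifs <;> simp

theorem underSign_mul_self (ι : H → H) (n u : H) :
    underSign R ι n u * underSign R ι n u = 1 := by
  unfold underSign; split_ifs <;> simp

theorem crossingSign_mul_self (ι : H → H) (X : Finset H) :
    crossingSign R ι X * crossingSign R ι X = 1 := by
  simp only [crossingSign, ← Finset.prod_mul_distrib, crossSign_mul_self, Finset.prod_const_one]

theorem crossSign_four {ι : H → H} (hι : Function.Involutive ι) {a n : H} (hna : n ≠ a)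
    (hna' : n ≠ ι a) (ha : ι a ≠ a) (hn : ι n ≠ n) :
    (crossSign R ι n a * crossSign R ι n (ι a) * crossSign R ι a n * crossSign R ι (ι a) n) *
    (crossSign R ι (ι n) a * crossSign R ι (ι n) (ι a) * crossSign R ι a (ι n) *
      crossSign R ι (ι a) (ι n)) *
    ((ordSign R n a * ordSign R n (ι a)) * (ordSign R (ι n) a * ordSign R (ι n) (ι a))) = 1 := by
  have h1 : ι n ≠ a := fun h => hna' (by rw [← h, hι])
  have h2 : ι n ≠ ι a := fun h => hna (hι.injective h)
  simp only [crossSign, ordSign, hι _]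
  generalize ι n = n' at *
  generalize ι a = a' at *
  rcases lt_or_gt_of_ne hna with h1 | h1 <;> rcases lt_or_gt_of_ne hna' with h2 | h2 <;>
  rcases lt_or_gt_of_ne ha with h3 | h3 <;> rcases lt_or_gt_of_ne hn with h4 | h4 <;>
  rcases lt_or_gt_of_ne ‹n' ≠ a› with h5 | h5 <;> rcases lt_or_gt_of_ne ‹n' ≠ a'› with h6 | h6 <;>
  first
  | (exfalso; order)
  | simp [h1, h2, h5, h6, h1.not_gt, h2.not_gt, h5.not_gt, h6.not_gt]

theorem underSign_four {ι : H → H} (hι : Function.Involutive ι) {a k n : H} (hna : n ≠ a)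
    (hnk : n ≠ k) (hna' : ι n ≠ a) (hnk' : ι n ≠ k) (hn : ι n ≠ n) :
    (underSign R ι n a * underSign R ι n k) * (underSign R ι (ι n) a * underSign R ι (ι n) k) *
    ((ordSign R n a * ordSign R n k) * (ordSign R (ι n) a * ordSign R (ι n) k)) = 1 := by
  simp only [underSign, ordSign, hι _]
  generalize ι n = n' at *
  rcases lt_or_gt_of_ne hna with h1 | h1 <;> rcases lt_or_gt_of_ne hna' with h2 | h2 <;>
  rcases lt_or_gt_of_ne hnk with h3 | h3 <;> rcases lt_or_gt_of_ne hn with h4 | h4 <;>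
  rcases lt_or_gt_of_ne hnk' with h5 | h5 <;>
  first
  | (exfalso; order)
  | simp [h1, h2, h3, h5, h1.not_gt, h2.not_gt, h3.not_gt, h5.not_gt]

theorem underSign_pair {ι : H → H} (hι : Function.Involutive ι) {a u : H} (hua : u ≠ a)
    (hua' : u ≠ ι a) (ha : ι a ≠ a) :
    underSign R ι a u * underSign R ι (ι a) u = ordSign R u a * ordSign R u (ι a) := by
  simp only [underSign, ordSign, hι _]
  rcases lt_or_gt_of_ne hua with h1 | h1 <;> rcases lt_or_gt_of_ne hua' with h2 | h2 <;>
  rcases lt_or_gt_of_ne ha with h3 | h3 <;>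
  first
  | (exfalso; order)
  | simp [h1, h2, h1.not_gt, h2.not_gt]

theorem crossingSign_insert {ι : H → H} {N : Finset H} {a : H} (ha : a ∉ N) :
    crossingSign R ι (insert a N) =
      crossingSign R ι N * ∏ n ∈ N, crossSign R ι n a * crossSign R ι a n := by
  have : crossSign R ι a a = 1 := by simp [crossSign]
  simp only [crossingSign, Finset.prod_insert ha, Finset.prod_mul_distrib, this]
  ring

theorem chordSign_insert_chord {ι : H → H} (hι : Function.Involutive ι) (hne : ∀ h, ι h ≠ h)
    {N U : Finset H} (hN : ∀ n ∈ N, ι n ∈ N) {a : H} (haN : a ∉ N) (haU : a ∉ U)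
    (haU' : ι a ∉ U) :
    chordSign R ι (insert a (insert (ι a) N)) U =
      chordSign R ι N U * ((∏ n ∈ N, ordSign R n a * ordSign R n (ι a)) *
        ∏ u ∈ U, ordSign R u a * ordSign R u (ι a)) := by
  have haN' : ι a ∉ N := fun h => haN (by simpa [hι a] using hN _ h)
  have ha1 : a ∉ insert (ι a) N := by simp [haN, (hne a).symm]
  have h1 : ∏ n ∈ N, (crossSign R ι n a * crossSign R ι n (ι a) * crossSign R ι a n *
      crossSign R ι (ι a) n) = ∏ n ∈ N, ordSign R n a * ordSign R n (ι a) := by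
    apply prod_eq_prod_of_invol hι hne hN
    · intro n hn
      linear_combination ordSign_mul_self (R := R) n (ι a) + ordSign R n (ι a) ^ 2 *
        ordSign_mul_self (R := R) n a
    · intro n hn
      exact crossSign_four hι (fun h => haN (h ▸ hn)) (fun h => haN' (h ▸ hn)) (hne a) (hne n)
  have h2 : ∏ u ∈ U, underSign R ι a u * underSign R ι (ι a) u =
      ∏ u ∈ U, ordSign R u a * ordSign R u (ι a) :=
    Finset.prod_congr rfl fun u hu =>
      underSign_pair hι (fun h => haU (h ▸ hu)) (fun h => haU' (h ▸ hu)) (hne a)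
  have h3 : crossSign R ι a (ι a) = 1 := by
    simp [crossSign]
  have h4 : crossSign R ι (ι a) a = 1 := by
    rw [crossSign, if_neg]; rw [hι]; exact fun h => lt_irrefl _ (h.2.1)
  rw [← h1, ← h2]
  simp only [chordSign, crossingSign_insert ha1, crossingSign_insert haN',
    Finset.prod_insert ha1, Finset.prod_insert haN', h3, h4, Finset.prod_mul_distrib]
  ring

theorem chordSign_insert_under {ι : H → H} (hι : Function.Involutive ι) (hne : ∀ h, ι h ≠ h)
    {N U : Finset H} (hN : ∀ n ∈ N, ι n ∈ N) {a k : H} (hak : a ≠ k) (haN : a ∉ N) (hkN : k ∉ N)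
    (haU : a ∉ U) (hkU : k ∉ U) :
    chordSign R ι N (insert a (insert k U)) =
      chordSign R ι N U * ∏ n ∈ N, ordSign R n a * ordSign R n k := by
  have h1 : ∏ n ∈ N, underSign R ι n a * underSign R ι n k =
      ∏ n ∈ N, ordSign R n a * ordSign R n k := by
    apply prod_eq_prod_of_invol hι hne hN
    · intro n hn
      linear_combination ordSign_mul_self (R := R) n k + ordSign R n k ^ 2 *
        ordSign_mul_self (R := R) n a
    · intro n hn
      have := hN n hn
      exact underSign_four hι (fun h => haN (h ▸ hn)) (fun h => hkN (h ▸ hn))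
        (fun h => haN (h ▸ this)) (fun h => hkN (h ▸ this)) (hne n)
  have h2 : a ∉ insert k U := by simp [haU, hak]
  rw [← h1]
  simp only [chordSign, Finset.prod_insert h2, Finset.prod_insert hkU, Finset.prod_mul_distrib]
  ring

/-- Among an involution-closed set of points, the chord sign only depends on crossings. -/
theorem chordSign_sdiff {ι : H → H} (hι : Function.Involutive ι) (hne : ∀ h, ι h ≠ h)
    {N U : Finset H} (hN : ∀ n ∈ N, ι n ∈ N) (hU : ∀ n ∈ U, ι n ∈ U) (hd : Disjoint N U) :
    chordSign R ι N U = crossingSign R ι (N ∪ U) * crossingSign R ι U := by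
  have h1 : crossingSign R ι (N ∪ U) = crossingSign R ι N * crossingSign R ι U *
      ∏ n ∈ N, ∏ u ∈ U, crossSign R ι n u * crossSign R ι u n := by
    have h3 : ∏ u ∈ U, ∏ n ∈ N, crossSign R ι u n = ∏ n ∈ N, ∏ u ∈ U, crossSign R ι u n :=
      Finset.prod_comm
    simp only [crossingSign, Finset.prod_union hd, Finset.prod_mul_distrib, h3]
    ring
  have h2 : ∏ n ∈ N, ∏ u ∈ U, crossSign R ι n u * crossSign R ι u n =
      ∏ n ∈ N, ∏ u ∈ U, underSign R ι n u := by
    apply prod_eq_prod_of_invol hι hne hN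
    · intro n hn
      simp only [← Finset.prod_mul_distrib, underSign_mul_self, Finset.prod_const_one]
    · intro n hn
      simp only [← Finset.prod_mul_distrib]
      refine Finset.prod_involution (fun u _ => ι u) ?_ (fun u _ _ => hne u)
        (fun u hu => hU u hu) (fun u _ => hι u)
      intro u hu
      have e1 : u ≠ n := fun h => Finset.disjoint_left.1 hd hn (h ▸ hu)
      have e2 : u ≠ ι n := fun h => Finset.disjoint_left.1 hd (hN n hn) (h ▸ hu)
      have e3 := crossSign_four (R := R) hι e1 e2 (hne n) (hne u)
      have e4 := underSign_pair (R := R) hι e1 e2 (hne n)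
      have e5 := underSign_pair (R := R) hι (a := n) (u := ι u)
        (fun h => e2 (by rw [← h, hι])) (fun h => e1 (hι.injective h)) (hne n)
      rw [← e4, ← e5] at e3
      linear_combination e3
  rw [h1, h2, chordSign]
  linear_combination -(crossingSign R ι N * ∏ n ∈ N, ∏ u ∈ U, underSign R ι n u) *
    crossingSign_mul_self (R := R) ι U

end Chords

theorem Finset.sum_powerset_sum_erase {α R : Type*} [DecidableEq α] [AddCommMonoid R]
    (S : Finset α) (g : α → Finset α → R) :
    ∑ U ∈ S.powerset, ∑ k ∈ U, g k (U.erase k) =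
      ∑ k ∈ S, ∑ U ∈ (S.erase k).powerset, g k U := by
  have h1 : ∀ U ∈ S.powerset, ∑ k ∈ U, g k (U.erase k) =
      ∑ k ∈ S, if k ∈ U then g k (U.erase k) else 0 := by
    intro U hU
    rw [← Finset.sum_filter, Finset.filter_mem_eq_inter,
      Finset.inter_eq_right.2 (Finset.mem_powerset.1 hU)]
  rw [Finset.sum_congr rfl h1, Finset.sum_comm]
  refine Finset.sum_congr rfl fun k hk => ?_
  conv_lhs => rw [← Finset.insert_erase hk]
  rw [Finset.sum_powerset_insert (Finset.notMem_erase k S), Finset.sum_eq_zero, zero_add]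
  · refine Finset.sum_congr rfl fun U hU => ?_
    have hkU : k ∉ U := fun h => Finset.notMem_erase k S (Finset.mem_powerset.1 hU h)
    rw [if_pos (Finset.mem_insert_self k U), Finset.erase_insert hkU]
  · intro U hU
    exact if_neg fun h => Finset.notMem_erase k S (Finset.mem_powerset.1 hU h)

/-- Every block of points above a vertex meets `U` in an even number of points. -/
def EvenAt {H V : Type*} [DecidableEq V] (vert : H → V) (U : Finset H) : Prop :=
  ∀ v, Even (U.filter (fun h => vert h = v)).card

theorem evenAt_insert_insert {H V : Type*} [DecidableEq H] [DecidableEq V] {vert : H → V}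
    {U : Finset H} {a k : H} (hak : a ≠ k) (ha : a ∉ U) (hk : k ∉ U) (h : vert k = vert a) :
    EvenAt vert (insert a (insert k U)) ↔ EvenAt vert U := by
  refine forall_congr' fun v => ?_
  by_cases hv : vert a = v
  · have h1 : k ∉ U.filter (fun h => vert h = v) := by simp [hk]
    have h2 : a ∉ insert k (U.filter (fun h => vert h = v)) := by simp [ha, hak]
    rw [Finset.filter_insert, if_pos hv, Finset.filter_insert, if_pos (h.trans hv),
      Finset.card_insert_of_notMem h2, Finset.card_insert_of_notMem h1]
    simp [Nat.even_add_one]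
  · rw [Finset.filter_insert, if_neg hv, Finset.filter_insert, if_neg (by rwa [h])]

section PfaffianSum

variable {R : Type*} [CommRing R] {H V : Type*} [LinearOrder H] [DecidableEq V]

open scoped Classical in
/-- The contribution of the configuration `U ⊆ S` to `pfSum`. -/
noncomputable def pfTerm (ι : H → H) (vert : H → V) (z : H → R) (S U : Finset H) : R :=
  if (∀ h ∈ S \ U, ι h ∈ S \ U) ∧ EvenAt vert U then
    chordSign R ι (S \ U) U * ∏ h ∈ U, z h else 0

/-- The signed sum over the subsets `U` of `S` that are even in each block and whose complement
is a union of pairs `{h, ι h}`. It is the Pfaffian of the principal submatrix of `pfMatrix`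
indexed by `S`. -/
noncomputable def pfSum (ι : H → H) (vert : H → V) (z : H → R) (S : Finset H) : R :=
  ∑ U ∈ S.powerset, pfTerm ι vert z S U

/-- The absolute values of the entries of `pfMatrix`. -/
def pfWeight (ι : H → H) (vert : H → V) (z : H → R) (a k : H) : R :=
  (if k = ι a then 1 else 0) + if vert k = vert a then z a * z k else 0

theorem pfTerm_of_notMem {ι : H → H} (hι : Function.Involutive ι) (hne : ∀ h, ι h ≠ h)
    (vert : H → V) (z : H → R) {S U : Finset H} {a : H} (ha : a ∈ S) (ha' : ι a ∈ S)
    (hU : U ⊆ (S.erase a).erase (ι a)) :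
    pfTerm ι vert z S U =
      -(rankSign R S a * rankSign R S (ι a)) * pfTerm ι vert z ((S.erase a).erase (ι a)) U := by
  set S' := (S.erase a).erase (ι a) with hS'
  have haU : a ∉ U := fun h => by simpa [S'] using hU h
  have haU' : ι a ∉ U := fun h => by simpa [S'] using hU h
  have haS' : a ∉ S' := by simp [S']
  have haS'' : ι a ∉ S' := by simp [S']
  have hS : S \ U = insert a (insert (ι a) (S' \ U)) := by
    ext x
    simp only [S', Finset.mem_sdiff, Finset.mem_insert, Finset.mem_erase]
    by_cases h1 : x = a
    · subst h1; simp [ha, haU]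
    · by_cases h2 : x = ι a
      · subst h2; simp [ha', haU']
      · simp [h1, h2]
  have hcond : (∀ h ∈ S \ U, ι h ∈ S \ U) ↔ ∀ h ∈ S' \ U, ι h ∈ S' \ U := by
    rw [hS]
    constructor
    · intro H h hh
      have h1 := H h (by simp only [Finset.mem_insert, hh, or_true])
      have hmem := (Finset.mem_sdiff.1 hh).1
      simp only [Finset.mem_insert] at h1
      rcases h1 with h1 | h1 | h1
      · exact absurd (by rw [← h1, hι]; exact hmem) haS''
      · exact absurd (by rw [← hι.injective h1]; exact hmem) haS'
      · exact h1
    · intro H h hh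
      simp only [Finset.mem_insert] at hh ⊢
      rcases hh with rfl | rfl | hh
      · simp
      · simp [hι a]
      · exact Or.inr (Or.inr (H h hh))
  unfold pfTerm
  by_cases h : (∀ h ∈ S' \ U, ι h ∈ S' \ U) ∧ EvenAt vert U
  · rw [if_pos h, if_pos ⟨hcond.2 h.1, h.2⟩]
    have hsplit : ∏ s ∈ S', ordSign R s a * ordSign R s (ι a) =
        (∏ s ∈ S' \ U, ordSign R s a * ordSign R s (ι a)) *
          ∏ s ∈ U, ordSign R s a * ordSign R s (ι a) := (Finset.prod_sdiff hU).symm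
    rw [rankSign_mul_rankSign ha ha' (hne a).symm, ← hS', hsplit, hS,
      chordSign_insert_chord hι hne h.1 (fun h => haS' (Finset.mem_sdiff.1 h).1) haU haU']
    ring
  · rw [if_neg h, if_neg fun h' => h ⟨hcond.1 h'.1, h'.2⟩, mul_zero]

theorem pfTerm_insert {ι : H → H} (hι : Function.Involutive ι) (hne : ∀ h, ι h ≠ h)
    {vert : H → V} (hconv : ∀ a b h : H, a < h → h < b → vert a = vert b → vert h = vert a)
    (z : H → R) {S U : Finset H} {a k : H} (ha : a ∈ S) (hU : U ⊆ S.erase a) (hk : k ∈ U)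
    (hv : vert k = vert a) :
    -(rankSign R S a * rankSign R S k) * (z a * z k) *
        pfTerm ι vert z ((S.erase a).erase k) (U.erase k) =
      -(rankSign R ((insert a U).filter (fun h => vert h = vert a)) a *
        rankSign R ((insert a U).filter (fun h => vert h = vert a)) k) *
          pfTerm ι vert z S (insert a U) := by
  obtain ⟨U', hkU', rfl⟩ : ∃ U', k ∉ U' ∧ U = insert k U' :=
    ⟨U.erase k, Finset.notMem_erase _ _, (Finset.insert_erase hk).symm⟩
  rw [Finset.erase_insert hkU']
  have haU : a ∉ insert k U' := fun h => by simpa using hU h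
  have hak : a ≠ k := fun h => haU (by simp [h])
  have haU' : a ∉ U' := fun h => haU (by simp [h])
  have hkS : k ∈ S := Finset.mem_of_mem_erase (hU hk)
  set S' := (S.erase a).erase k with hS'
  have hU'S : U' ⊆ S' := by
    intro x hx
    have := hU (Finset.mem_insert_of_mem hx)
    rw [hS', Finset.mem_erase]
    exact ⟨fun h => hkU' (h ▸ hx), this⟩
  have hN : S \ insert a (insert k U') = S' \ U' := by
    ext x
    simp only [S', Finset.mem_sdiff, Finset.mem_insert, Finset.mem_erase]
    tauto
  have haN : a ∉ S' \ U' := by simp [S']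
  have hkN : k ∉ S' \ U' := by simp [S']
  unfold pfTerm
  rw [hN, evenAt_insert_insert hak haU' hkU' hv]
  split_ifs with h
  · set B := (insert a (insert k U')).filter (fun h => vert h = vert a) with hB
    have haB : a ∈ B := by simp [B]
    have hkB : k ∈ B := by simp [B, hv]
    have hBU : (B.erase a).erase k ⊆ U' := by
      intro x hx
      simp only [B, Finset.mem_erase, Finset.mem_filter, Finset.mem_insert] at hx
      tauto
    have h1 : ∏ s ∈ (B.erase a).erase k, ordSign R s a * ordSign R s k =
        ∏ s ∈ U', ordSign R s a * ordSign R s k := by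
      apply Finset.prod_subset hBU
      intro x hx hxB
      have hxa : x ≠ a := fun h => haU' (h ▸ hx)
      have hxk : x ≠ k := fun h => hkU' (h ▸ hx)
      have hvx : vert x ≠ vert a := by
        intro h
        exact hxB (by simp [B, hxa, hxk, h, hx])
      unfold ordSign
      rcases lt_or_gt_of_ne hxa with h1 | h1 <;> rcases lt_or_gt_of_ne hxk with h2 | h2
      · simp [h1.not_gt, h2.not_gt]
      · exact absurd ((hconv k a x h2 h1 hv).trans hv) hvx
      · exact absurd (hconv a k x h1 h2 hv.symm) hvx
      · simp [h1, h2]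
    have hsplit : ∏ s ∈ S', ordSign R s a * ordSign R s k =
        (∏ s ∈ S' \ U', ordSign R s a * ordSign R s k) *
          ∏ s ∈ U', ordSign R s a * ordSign R s k := (Finset.prod_sdiff hU'S).symm
    rw [rankSign_mul_rankSign ha hkS hak, ← hS', rankSign_mul_rankSign haB hkB hak, h1, hsplit,
      chordSign_insert_under hι hne h.1 hak haN hkN haU' hkU', Finset.prod_insert haU,
      Finset.prod_insert hkU']
    ring
  · simp

/-- Expansion of `pfSum` along the row of any point `a ∈ S`. -/
theorem pfSum_expand {ι : H → H} (hι : Function.Involutive ι) (hne : ∀ h, ι h ≠ h)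
    {vert : H → V} (hconv : ∀ a b h : H, a < h → h < b → vert a = vert b → vert h = vert a)
    (z : H → R) {S : Finset H} {a : H} (ha : a ∈ S) :
    pfSum ι vert z S = -rankSign R S a * ∑ k ∈ S.erase a,
      rankSign R S k * pfWeight ι vert z a k * pfSum ι vert z ((S.erase a).erase k) := by
  have hpart1 : ∑ U ∈ (S.erase a).powerset, pfTerm ι vert z S U =
      -rankSign R S a * ∑ k ∈ S.erase a, if k = ι a then
        rankSign R S k * pfSum ι vert z ((S.erase a).erase k) else 0 := by
    rw [Finset.sum_ite_eq']
    split_ifs with h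
    · have hS : ι a ∈ S := Finset.mem_of_mem_erase h
      conv_lhs => rw [← Finset.insert_erase h]
      have hzero : ∑ U ∈ ((S.erase a).erase (ι a)).powerset,
          pfTerm ι vert z S (insert (ι a) U) = 0 := by
        refine Finset.sum_eq_zero fun U hU => if_neg fun hc => ?_
        have haU : a ∉ insert (ι a) U := by
          intro h
          rcases Finset.mem_insert.1 h with h | h
          · exact hne a h.symm
          · simpa using Finset.mem_powerset.1 hU h
        have := hc.1 a (Finset.mem_sdiff.2 ⟨ha, haU⟩)
        simp at this
      rw [Finset.sum_powerset_insert (Finset.notMem_erase _ _), hzero, add_zero,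
        Finset.sum_congr rfl (fun U hU =>
          pfTerm_of_notMem hι hne vert z ha hS (Finset.mem_powerset.1 hU)),
        ← Finset.mul_sum, pfSum]
      ring
    · rw [mul_zero]
      refine Finset.sum_eq_zero fun U hU => if_neg fun hc => h ?_
      have haU : a ∉ U := fun h => by simpa using Finset.mem_powerset.1 hU h
      have := hc.1 a (Finset.mem_sdiff.2 ⟨ha, haU⟩)
      exact Finset.mem_erase.2 ⟨hne a, (Finset.mem_sdiff.1 this).1⟩
  have hpart2 : ∑ U ∈ (S.erase a).powerset, pfTerm ι vert z S (insert a U) =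
      -rankSign R S a * ∑ k ∈ S.erase a, if vert k = vert a then
        rankSign R S k * (z a * z k) * pfSum ι vert z ((S.erase a).erase k) else 0 := by
    have key : ∀ U ∈ (S.erase a).powerset, pfTerm ι vert z S (insert a U) =
        ∑ k ∈ U, if vert k = vert a then -(rankSign R S a * rankSign R S k) * (z a * z k) *
          pfTerm ι vert z ((S.erase a).erase k) (U.erase k) else 0 := by
      intro U hU
      rw [Finset.mem_powerset] at hU
      have haU : a ∉ U := fun h => by simpa using hU h
      set B := (insert a U).filter (fun h => vert h = vert a) with hB
      have hBU : U.filter (fun h => vert h = vert a) = B.erase a := by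
        rw [hB, Finset.filter_insert, if_pos rfl, Finset.erase_insert]
        simp [haU]
      have haB : a ∈ B := by simp [B]
      rw [← Finset.sum_filter, Finset.sum_congr rfl (fun k hk =>
        pfTerm_insert hι hne hconv z ha hU (Finset.mem_filter.1 hk).1 (Finset.mem_filter.1 hk).2),
        ← hB, hBU, ← Finset.sum_mul, Finset.sum_neg_distrib, ← Finset.mul_sum]
      by_cases hE : EvenAt vert (insert a U)
      · have h1 := sum_rankSign (R := R) B
        rw [if_pos (hE (vert a)), ← Finset.add_sum_erase _ _ haB] at h1
        linear_combination -(pfTerm ι vert z S (insert a U)) * rankSign_mul_self (R := R) B a +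
          rankSign R B a * (pfTerm ι vert z S (insert a U)) * h1
      · rw [pfTerm, if_neg (fun h => hE h.2), mul_zero]
    rw [Finset.sum_congr rfl key, Finset.sum_powerset_sum_erase (S.erase a) (fun k U =>
      if vert k = vert a then -(rankSign R S a * rankSign R S k) * (z a * z k) *
          pfTerm ι vert z ((S.erase a).erase k) U else 0), Finset.mul_sum]
    refine Finset.sum_congr rfl fun k _ => ?_
    split_ifs with h
    · rw [← Finset.mul_sum, pfSum]; ring
    · simp
  have hS : pfSum ι vert z S = ∑ U ∈ (insert a (S.erase a)).powerset, pfTerm ι vert z S U := by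
    rw [Finset.insert_erase ha, pfSum]
  rw [hS, Finset.sum_powerset_insert (Finset.notMem_erase a S), hpart1, hpart2, ← mul_add,
    ← Finset.sum_add_distrib]
  congr 1
  refine Finset.sum_congr rfl fun k _ => ?_
  unfold pfWeight
  split_ifs <;> ring

end PfaffianSum

theorem Finset.sum_sum_erase_eq_zero {α R : Type*} [DecidableEq α] [AddCommGroup R]
    (X : Finset α) (T : α → α → R) (hT : ∀ j ∈ X, ∀ l ∈ X, j ≠ l → T j l + T l j = 0) :
    ∑ j ∈ X, ∑ l ∈ X.erase j, T j l = 0 := by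
  have h1 : ∀ j ∈ X, ∑ l ∈ X.erase j, T j l = ∑ l ∈ X, if j = l then 0 else T j l := by
    intro j hj
    rw [← Finset.add_sum_erase X _ hj, if_pos rfl, zero_add]
    exact Finset.sum_congr rfl fun l hl => (if_neg (Finset.ne_of_mem_erase hl).symm).symm
  rw [Finset.sum_congr rfl h1, ← Finset.sum_product']
  refine Finset.sum_involution (fun p _ => p.swap) ?_ ?_ ?_ ?_
  · rintro ⟨j, l⟩ h
    rw [Finset.mem_product] at h
    by_cases hjl : j = l
    · simp [hjl]
    · simp [hjl, Ne.symm hjl, hT j h.1 l h.2 hjl]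
  · rintro ⟨j, l⟩ _ h hs
    simp only [Prod.swap_prod_mk, Prod.mk.injEq] at hs
    exact h (if_pos hs.2)
  · rintro ⟨j, l⟩ h
    simpa [and_comm] using h
  · rintro ⟨j, l⟩ _
    rfl

theorem Matrix.det_subtype_pair {R H : Type*} [CommRing R] [DecidableEq H] {e f : H} (h : e ≠ f)
    [Fintype {x // x = e ∨ x = f}] (M : Matrix {x // x = e ∨ x = f} {x // x = e ∨ x = f} R) :
    M.det = M ⟨e, Or.inl rfl⟩ ⟨e, Or.inl rfl⟩ * M ⟨f, Or.inr rfl⟩ ⟨f, Or.inr rfl⟩ -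
      M ⟨e, Or.inl rfl⟩ ⟨f, Or.inr rfl⟩ * M ⟨f, Or.inr rfl⟩ ⟨e, Or.inl rfl⟩ := by
  let g : Fin 2 → {x // x = e ∨ x = f} := ![⟨e, Or.inl rfl⟩, ⟨f, Or.inr rfl⟩]
  have hg : Function.Bijective g := by
    constructor
    · intro i j hij
      fin_cases i <;> fin_cases j <;> simp_all [g]
    · rintro ⟨x, rfl | rfl⟩
      · exact ⟨0, rfl⟩
      · exact ⟨1, rfl⟩
  rw [← Matrix.det_submatrix_equiv_self (Equiv.ofBijective g hg), Matrix.det_fin_two]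
  rfl

section PfaffianMatrix

variable {R : Type*} [CommRing R] {H V : Type*} [LinearOrder H] [DecidableEq V]

/-- The antisymmetric matrix whose Pfaffian is `pfSum`. -/
def pfMatrix (ι : H → H) (vert : H → V) (z : H → R) : Matrix H H R :=
  Matrix.of fun i j => if i = j then 0 else ordSign R i j * pfWeight ι vert z i j

theorem pfMatrix_apply (ι : H → H) (vert : H → V) (z : H → R) (i j : H) :
    pfMatrix ι vert z i j = if i = j then 0 else ordSign R i j * pfWeight ι vert z i j := rfl

theorem pfSum_congr (ι : H → H) (vert : H → V) {z z' : H → R} {S : Finset H}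
    (h : ∀ s ∈ S, z s = z' s) : pfSum ι vert z S = pfSum ι vert z' S := by
  refine Finset.sum_congr rfl fun U hU => ?_
  rw [pfTerm, pfTerm, Finset.prod_congr rfl fun u hu => h u (Finset.mem_powerset.1 hU hu)]

theorem map_pfSum {K : Type*} [CommRing K] (φ : R →+* K) (ι : H → H) (vert : H → V) (z : H → R)
    (S : Finset H) : φ (pfSum ι vert z S) = pfSum ι vert (fun h => φ (z h)) S := by
  rw [pfSum, pfSum, map_sum]
  refine Finset.sum_congr rfl fun U _ => ?_
  simp only [pfTerm, chordSign, crossingSign, crossSign, underSign, apply_ite φ, map_mul, map_prod,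
    map_neg, map_one, map_zero]

variable [Fintype H]

/-- The `a`-th column of the Pfaffian adjugate of `pfMatrix`. -/
noncomputable def pfColumn (ι : H → H) (vert : H → V) (z : H → R) (a j : H) : R :=
  if j = a then 0 else
    -(ordSign R a j * (rankSign R Finset.univ a * rankSign R Finset.univ j)) *
      pfSum ι vert z ((Finset.univ.erase a).erase j)

theorem pfMatrix_mulVec_pfColumn {ι : H → H} (hι : Function.Involutive ι) (hne : ∀ h, ι h ≠ h)
    {vert : H → V} (hconv : ∀ a b h : H, a < h → h < b → vert a = vert b → vert h = vert a)
    (z : H → R) (a : H) :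
    (pfMatrix ι vert z).mulVec (pfColumn ι vert z a) =
      Pi.single a (pfSum ι vert z Finset.univ) := by
  funext i
  rw [Matrix.mulVec, dotProduct]
  by_cases hi : i = a
  · subst hi
    rw [Pi.single_eq_same, pfSum_expand hι hne hconv z (Finset.mem_univ i), Finset.mul_sum,
      ← Finset.add_sum_erase _ _ (Finset.mem_univ i), pfMatrix_apply, if_pos rfl, zero_mul,
      zero_add]
    refine Finset.sum_congr rfl fun j hj => ?_
    have hj := Finset.ne_of_mem_erase hj
    rw [pfMatrix_apply, if_neg hj.symm, pfColumn, if_neg hj]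
    linear_combination -(rankSign R Finset.univ i * rankSign R Finset.univ j *
      pfWeight ι vert z i j * pfSum ι vert z ((Finset.univ.erase i).erase j)) *
      ordSign_mul_self (R := R) i j
  · rw [Pi.single_eq_of_ne hi]
    set X : Finset H := (Finset.univ.erase a).erase i with hX
    have hiX : i ∉ X := by simp [X]
    have hsub : ∑ j, pfMatrix ι vert z i j * pfColumn ι vert z a j =
        ∑ j ∈ X, pfMatrix ι vert z i j * pfColumn ι vert z a j := by
      symm
      apply Finset.sum_subset (Finset.subset_univ _)
      intro j _ hj
      by_cases h : j = a
      · simp [pfColumn, h]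
      · have : i = j := by
          by_contra h'
          exact hj (by simp [X, h, Ne.symm h'])
        simp [pfMatrix_apply, this]
    rw [hsub]
    let T : H → H → R := fun j l =>
      ordSign R i j * pfWeight ι vert z i j * (ordSign R a j *
        (rankSign R Finset.univ a * rankSign R Finset.univ j)) *
        ((ordSign R j i * (ordSign R a i * rankSign R Finset.univ i)) *
        ((ordSign R j l * (ordSign R a l * rankSign R Finset.univ l)) * pfWeight ι vert z i l *
          pfSum ι vert z ((X.erase j).erase l)))
    rw [← Finset.sum_sum_erase_eq_zero X T]
    · refine Finset.sum_congr rfl fun j hj => ?_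
      have hja : j ≠ a := by rintro rfl; simp [X] at hj
      have hji : j ≠ i := fun h => hiX (h ▸ hj)
      have hi' : i ∈ (Finset.univ.erase a).erase j := by simp [hi, hji.symm]
      have hj' : j ∈ Finset.univ.erase a := by simp [hja]
      have hXj : ((Finset.univ.erase a).erase j).erase i = X.erase j := by
        rw [hX, Finset.erase_right_comm]
      rw [pfMatrix_apply, if_neg hji.symm, pfColumn, if_neg hja,
        pfSum_expand hι hne hconv z hi', hXj, Finset.mul_sum, Finset.mul_sum, Finset.mul_sum]
      refine Finset.sum_congr rfl fun l _ => ?_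
      rw [rankSign_erase hj', rankSign_erase hj', rankSign_erase (Finset.mem_univ a),
        rankSign_erase (Finset.mem_univ a)]
      simp only [T]
      ring
    · intro j hj l hl hjl
      have hja : j ≠ a := by rintro rfl; simp [X] at hj
      have hji : j ≠ i := fun h => hiX (h ▸ hj)
      have hla : l ≠ a := by rintro rfl; simp [X] at hl
      have hli : l ≠ i := fun h => hiX (h ▸ hl)
      have hXjl : (X.erase l).erase j = (X.erase j).erase l := Finset.erase_right_comm
      simp only [T]
      rw [hXjl, ordSign_swap hjl, ordSign_swap hji.symm, ordSign_swap hli.symm]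
      linear_combination
        (-(pfWeight ι vert z i j * ordSign R a j *
        (rankSign R Finset.univ a * rankSign R Finset.univ j) *
        (ordSign R a i * rankSign R Finset.univ i) *
        (ordSign R j l * (ordSign R a l * rankSign R Finset.univ l)) * pfWeight ι vert z i l *
          pfSum ι vert z ((X.erase j).erase l))) *
        (ordSign_mul_self (R := R) i j - ordSign_mul_self (R := R) i l)

theorem pfSum_zero (ι : H → H) (vert : H → V) :
    pfSum ι vert (0 : H → R) Finset.univ * pfSum ι vert (0 : H → R) Finset.univ = 1 := by
  have : pfSum ι vert (0 : H → R) Finset.univ = crossingSign R ι Finset.univ := by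
    rw [pfSum, Finset.sum_eq_single ∅]
    · rw [pfTerm, if_pos ⟨by simp, fun v => by simp⟩]
      simp [chordSign]
    · intro U _ hU
      obtain ⟨u, hu⟩ := Finset.nonempty_iff_ne_empty.2 hU
      rw [pfTerm, Finset.prod_eq_zero hu (Pi.zero_apply u), mul_zero, ite_self]
    · simp
  rw [this, crossingSign_mul_self]

theorem det_pfMatrix_mul {ι : H → H} (hι : Function.Involutive ι) (hne : ∀ h, ι h ≠ h)
    {vert : H → V} (hconv : ∀ a b h : H, a < h → h < b → vert a = vert b → vert h = vert a)
    (z : H → R) (e : H) {z' : H → R} (hz' : ∀ h, z' h = if h = e ∨ h = ι e then 0 else z h) :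
    (pfMatrix ι vert z).det * pfSum ι vert z' Finset.univ ^ 2 =
      pfSum ι vert z Finset.univ ^ 2 * (pfMatrix ι vert z').det := by
  set F := pfSum ι vert z Finset.univ with hF
  set c := pfSum ι vert z ((Finset.univ.erase e).erase (ι e)) with hc
  have he := hne e
  let p : H → Prop := fun h => h = e ∨ h = ι e
  let P : Matrix H H R := Matrix.of fun k l =>
    if l = e then pfColumn ι vert z e k else if l = ι e then pfColumn ι vert z (ι e) k else
      if k = l then 1 else 0
  set A := pfMatrix ι vert z with hA
  have hAP : ∀ k l, (A * P) k l = if l = e then (if k = e then F else 0) else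
      if l = ι e then (if k = ι e then F else 0) else A k l := by
    intro k l
    have h1 := fun a => congrFun (pfMatrix_mulVec_pfColumn hι hne hconv z a) k
    simp only [Matrix.mulVec, dotProduct, Pi.single_apply] at h1
    rw [Matrix.mul_apply]
    simp only [P, Matrix.of_apply]
    split_ifs with h2 h3 h3 h3
    · rw [h1 e, if_pos h3]
    · rw [h1 e, if_neg h3]
    · rw [h1 (ι e), if_pos ‹_›]
    · rw [h1 (ι e), if_neg ‹_›]
    · simp
  have hblk : ∀ M : Matrix H H R, (M.toSquareBlockProp p).det =
      M e e * M (ι e) (ι e) - M e (ι e) * M (ι e) e := fun M => Matrix.det_subtype_pair he.symm _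
  have hdetAP : (A * P).det = F ^ 2 * (A.toSquareBlockProp fun h => ¬ p h).det := by
    rw [Matrix.twoBlockTriangular_det (A * P) p]
    · congr 1
      · rw [hblk]
        simp [hAP, he]
        ring
      · congr 1
        ext ⟨k, hk⟩ ⟨l, hl⟩
        simp only [p, not_or] at hl
        simp [Matrix.toSquareBlockProp, hAP, hl.1, hl.2]
    · intro i hi j hj
      simp only [p, not_or] at hi
      rw [hAP]
      rcases hj with rfl | rfl
      · simp [hi.1]
      · simp [hi.2, he]
  have hdetP : P.det = c ^ 2 := by
    rw [Matrix.twoBlockTriangular_det' P p]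
    · have h1 : (P.toSquareBlockProp fun h => ¬ p h) = 1 := by
        ext ⟨k, hk⟩ ⟨l, hl⟩
        simp only [p, not_or] at hl
        simp [Matrix.toSquareBlockProp, P, hl.1, hl.2, Matrix.one_apply]
      rw [h1, Matrix.det_one, mul_one, hblk]
      have h2 : pfSum ι vert z ((Finset.univ.erase (ι e)).erase e) = c := by
        rw [hc, Finset.erase_right_comm]
      simp only [P, Matrix.of_apply, he, he.symm,
        if_true, if_false, pfColumn, h2, ← hc, ordSign_swap he]
      have e1 := rankSign_mul_self (R := R) Finset.univ e
      have e2 := rankSign_mul_self (R := R) Finset.univ (ι e)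
      have e3 := ordSign_mul_self (R := R) (ι e) e
      have e4 : (rankSign R Finset.univ e * rankSign R Finset.univ (ι e)) ^ 2 = 1 := by
        rw [mul_pow, pow_two, pow_two, e1, e2, one_mul]
      linear_combination c ^ 2 * (rankSign R Finset.univ e * rankSign R Finset.univ (ι e)) ^ 2 * e3
        + c ^ 2 * e4
    · intro i hi j hj
      simp only [p, not_or] at hj
      have : i ≠ j := by rintro rfl; exact (not_or.2 hj) hi
      simp [P, hj.1, hj.2, this]
  have hp0 : ∀ h, p h → z' h = 0 := fun h hh => by rw [hz']; exact if_pos hh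
  have hp1 : ∀ h, ¬ p h → z' h = z h := fun h hh => by rw [hz']; exact if_neg hh
  have hdetA' : (pfMatrix ι vert z').det = (A.toSquareBlockProp fun h => ¬ p h).det := by
    rw [Matrix.twoBlockTriangular_det' _ p]
    · have h1 : ((pfMatrix ι vert z').toSquareBlockProp fun h => ¬ p h) =
          A.toSquareBlockProp fun h => ¬ p h := by
        ext ⟨k, hk⟩ ⟨l, hl⟩
        simp [Matrix.toSquareBlockProp, hA, pfMatrix_apply, pfWeight, hp1 k hk, hp1 l hl]
      rw [h1, hblk]
      have e3 := ordSign_mul_self (R := R) (ι e) e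
      simp only [pfMatrix_apply,
        he, he.symm, if_true, if_false, pfWeight, hι e, hp0 e (Or.inl rfl), ordSign_swap he]
      simp only [zero_mul, mul_zero, ite_self, add_zero, mul_one]
      linear_combination (A.toSquareBlockProp fun h => ¬ p h).det * e3
    · intro i hi j hj
      have hij : j ≠ ι i := by
        simp only [p, not_or] at hj
        rcases hi with rfl | rfl
        · exact hj.2
        · rw [hι]; exact hj.1
      simp [pfMatrix_apply, pfWeight, hp0 i hi, hij]
  have hz'sum : pfSum ι vert z' Finset.univ ^ 2 = c ^ 2 := by
    have h1 : pfSum ι vert z' ((Finset.univ.erase e).erase (ι e)) = c := by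
      apply pfSum_congr
      intro s hs
      apply hp1
      simp only [Finset.mem_erase] at hs
      simp only [p, not_or]
      exact ⟨hs.2.1, hs.1⟩
    rw [pfSum_expand hι hne hconv z' (Finset.mem_univ e), Finset.sum_eq_single (ι e), h1]
    · have e1 := rankSign_mul_self (R := R) Finset.univ e
      have e2 := rankSign_mul_self (R := R) Finset.univ (ι e)
      simp only [pfWeight, hp0 e (Or.inl rfl), zero_mul, ite_self, add_zero, if_true, mul_one]
      linear_combination c ^ 2 * rankSign R Finset.univ e ^ 2 * e2 + c ^ 2 * e1
    · intro k _ hk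
      simp [pfWeight, hp0 e (Or.inl rfl), hk]
    · intro h
      exact absurd (Finset.mem_erase.2 ⟨he, Finset.mem_univ _⟩) h
  rw [hz'sum, hdetA', ← hdetAP, Matrix.det_mul, hdetP]

/-- The determinant of `pfMatrix` is the square of its Pfaffian `pfSum`. -/
theorem det_pfMatrix [IsDomain R] {K : Type*} [CommRing K] [Nontrivial K] (φ : R →+* K)
    {ι : H → H} (hι : Function.Involutive ι) (hne : ∀ h, ι h ≠ h) {vert : H → V}
    (hconv : ∀ a b h : H, a < h → h < b → vert a = vert b → vert h = vert a)
    {z : H → R} (hφ : ∀ h, φ (z h) = 0) :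
    (pfMatrix ι vert z).det =
      pfSum ι vert z Finset.univ ^ 2 * (pfMatrix ι vert (0 : H → R)).det := by
  suffices H : ∀ (T : Finset H) (z : H → R), (∀ h, φ (z h) = 0) → (∀ h ∉ T, z h = 0) →
      (pfMatrix ι vert z).det =
        pfSum ι vert z Finset.univ ^ 2 * (pfMatrix ι vert (0 : H → R)).det from
    H Finset.univ z hφ fun h hh => absurd (Finset.mem_univ h) hh
  intro T
  induction T using Finset.strongInduction with
  | H T ih =>
    intro z hz hT
    rcases T.eq_empty_or_nonempty with rfl | ⟨e, he⟩
    · obtain rfl : z = 0 := funext fun h => hT h (Finset.notMem_empty h)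
      rw [pow_two, pfSum_zero ι, one_mul]
    · let z' : H → R := fun h => if h = e ∨ h = ι e then 0 else z h
      have hz' : ∀ h, φ (z' h) = 0 := by
        intro h
        simp only [z']
        split_ifs <;> simp [hz]
      have h1 := ih (T.erase e) (Finset.erase_ssubset he) z' hz' (by
        intro h hh
        simp only [z']
        split_ifs with h2
        · rfl
        · exact hT h fun h3 => hh (Finset.mem_erase.2 ⟨fun h4 => h2 (Or.inl h4), h3⟩))
      have h2 := det_pfMatrix_mul hι hne hconv z e (z' := z') (fun h => rfl)
      have h3 : pfSum ι vert z' Finset.univ ≠ 0 := by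
        intro h
        have h4 := congrArg φ h
        have h5 : (fun h => φ (z' h)) = (0 : H → K) := funext hz'
        rw [map_pfSum, h5, map_zero] at h4
        have h6 := pfSum_zero (R := K) ι vert
        rw [h4, zero_mul] at h6
        exact zero_ne_one h6
      rw [h1] at h2
      refine mul_right_cancel₀ (pow_ne_zero 2 h3) ?_
      rw [h2]; ring

/-- If all even involution-closed sets have an even number of crossings, then `pfSum` is, up to
a global sign, an unsigned sum. -/
theorem pfSum_univ {ι : H → H} (hι : Function.Involutive ι) (hne : ∀ h, ι h ≠ h) {vert : H → V}
    (z : H → R) (hX : ∀ U : Finset H, (∀ h ∈ U, ι h ∈ U) → EvenAt vert U →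
      crossingSign R ι U = 1) {D : Finset (Finset H)}
    (hD : ∀ U, U ∈ D ↔ (∀ h ∈ U, ι h ∈ U) ∧ EvenAt vert U) :
    pfSum ι vert z Finset.univ = crossingSign R ι Finset.univ * ∑ U ∈ D, ∏ h ∈ U, z h := by
  have hcl : ∀ U : Finset H, (∀ h ∈ Finset.univ \ U, ι h ∈ Finset.univ \ U) ↔
      ∀ h ∈ U, ι h ∈ U := by
    intro U
    simp only [Finset.mem_sdiff, Finset.mem_univ, true_and]
    constructor
    · intro h u hu
      by_contra h'
      exact h _ h' (by rwa [hι])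
    · intro h u hu h'
      exact hu (by simpa [hι u] using h _ h')
  rw [pfSum, Finset.powerset_univ, Finset.mul_sum, ← Finset.sum_subset (Finset.subset_univ D)]
  · refine Finset.sum_congr rfl fun U hU => ?_
    have h := (hD U).1 hU
    rw [pfTerm, if_pos ⟨(hcl U).2 h.1, h.2⟩, chordSign_sdiff hι hne ((hcl U).2 h.1) h.1
      Finset.sdiff_disjoint, Finset.sdiff_union_of_subset (Finset.subset_univ U), hX U h.1 h.2,
      mul_one]
  · intro U _ hU
    rw [pfTerm, if_neg]
    rw [hcl, ← hD]
    exact hU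

end PfaffianMatrix

section PlaneGeometry

/-- The cross product of two plane vectors. -/
def crossProd (p q : ℂ) : ℝ := p.re * q.im - p.im * q.re

theorem crossProd_swap (p q : ℂ) : crossProd p q = -crossProd q p := by
  unfold crossProd; ring

theorem crossProd_eq_sin (p q : ℂ) :
    crossProd p q = ‖p‖ * ‖q‖ * Real.sin (q.arg - p.arg) := by
  rw [crossProd, Real.sin_sub, ← Complex.norm_mul_cos_arg p, ← Complex.norm_mul_sin_arg p,
    ← Complex.norm_mul_cos_arg q, ← Complex.norm_mul_sin_arg q]
  ring

theorem arg_lt_arg_iff_crossProd_pos {p q : ℂ} (hp : p ≠ 0) (hq : q ≠ 0)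
    (h1 : q.arg - p.arg < Real.pi) (h2 : p.arg - q.arg < Real.pi) :
    p.arg < q.arg ↔ 0 < crossProd p q := by
  have h : 0 < ‖p‖ * ‖q‖ := by positivity
  rw [crossProd_eq_sin, mul_pos_iff_of_pos_left h]
  constructor
  · intro h3
    exact Real.sin_pos_of_pos_of_lt_pi (by linarith) h1
  · intro h3
    by_contra! h4
    have := Real.sin_nonpos_of_nonpos_of_neg_pi_le (x := q.arg - p.arg) (by linarith) (by linarith)
    linarith

theorem ne_zero_of_im_ne_zero {p : ℂ} (h : p.im ≠ 0) : p ≠ 0 := by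
  rintro rfl
  exact h Complex.zero_im

theorem arg_lt_arg_iff_of_im_pos {p q : ℂ} (hp : 0 < p.im) (hq : 0 < q.im) :
    p.arg < q.arg ↔ 0 < crossProd p q := by
  have h1 := Complex.arg_nonneg_iff.2 hp.le
  have h2 := Complex.arg_nonneg_iff.2 hq.le
  have h3 := Complex.arg_lt_pi_iff.2 (Or.inr hp.ne')
  have h4 := Complex.arg_lt_pi_iff.2 (Or.inr hq.ne')
  exact arg_lt_arg_iff_crossProd_pos (ne_zero_of_im_ne_zero hp.ne')
    (ne_zero_of_im_ne_zero hq.ne') (by linarith) (by linarith)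

theorem arg_lt_arg_iff_of_im_neg {p q : ℂ} (hp : p.im < 0) (hq : q.im < 0) :
    p.arg < q.arg ↔ 0 < crossProd p q := by
  have h1 := Complex.arg_neg_iff.2 hp
  have h2 := Complex.arg_neg_iff.2 hq
  have h3 := Complex.neg_pi_lt_arg p
  have h4 := Complex.neg_pi_lt_arg q
  exact arg_lt_arg_iff_crossProd_pos (ne_zero_of_im_ne_zero hp.ne)
    (ne_zero_of_im_ne_zero hq.ne) (by linarith) (by linarith)

theorem mem_segment_of_crossProd_eq_zero {a b z : ℂ} (hab : b.im < a.im) (h1 : b.im ≤ z.im)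
    (h2 : z.im ≤ a.im) (h : crossProd (a - b) (z - b) = 0) : z ∈ segment ℝ a b := by
  have h3 : 0 < a.im - b.im := by linarith
  rw [segment_symm, segment_eq_image']
  refine ⟨(z.im - b.im) / (a.im - b.im), ⟨div_nonneg (by linarith) h3.le,
    (div_le_one h3).2 (by linarith)⟩, ?_⟩
  simp only [crossProd, Complex.sub_re, Complex.sub_im] at h
  apply Complex.ext
  · simp only [Complex.add_re, Complex.real_smul, Complex.mul_re, Complex.ofReal_re,
      Complex.ofReal_im, Complex.sub_re, zero_mul, sub_zero]
    field_simp
    linear_combination h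
  · simp only [Complex.add_im, Complex.real_smul, Complex.mul_im, Complex.ofReal_re,
      Complex.ofReal_im, Complex.sub_im, zero_mul, add_zero]
    field_simp
    ring

theorem segments_inter_of_crossProd {a b c d p q : ℂ} (hab : b.im < a.im)
    (hp : p ∈ segment ℝ c d) (hq : q ∈ segment ℝ c d)
    (hp1 : b.im ≤ p.im) (hp2 : p.im ≤ a.im) (hq1 : b.im ≤ q.im) (hq2 : q.im ≤ a.im)
    (h1 : 0 ≤ crossProd (a - b) (p - b)) (h2 : crossProd (a - b) (q - b) ≤ 0) :
    ∃ z, z ∈ segment ℝ a b ∩ segment ℝ c d := by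
  rcases eq_or_lt_of_le h1 with h3 | h3
  · exact ⟨p, mem_segment_of_crossProd_eq_zero hab hp1 hp2 h3.symm, hp⟩
  set P := crossProd (a - b) (p - b) with hP
  set Q := crossProd (a - b) (q - b) with hQ
  have h4 : 0 < P - Q := by linarith
  have e1 : 0 ≤ -Q / (P - Q) := div_nonneg (by linarith) h4.le
  have e2 : 0 ≤ P / (P - Q) := div_nonneg h1 h4.le
  have e3 : -Q / (P - Q) + P / (P - Q) = 1 := by field_simp; ring
  have hz := convex_segment (𝕜 := ℝ) c d hp hq e1 e2 e3
  have e4 : (P - Q) * (-Q / (P - Q)) = -Q := by field_simp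
  have e5 : (P - Q) * (P / (P - Q)) = P := by field_simp
  generalize -Q / (P - Q) = s at *
  generalize P / (P - Q) = t at *
  refine ⟨s • p + t • q, mem_segment_of_crossProd_eq_zero hab ?_ ?_ ?_, hz⟩
  · simp only [Complex.add_im, Complex.real_smul, Complex.mul_im, Complex.ofReal_re,
      Complex.ofReal_im, zero_mul, add_zero]
    linear_combination s * hp1 + t * hq1 + (-b.im) * e3
  · simp only [Complex.add_im, Complex.real_smul, Complex.mul_im, Complex.ofReal_re,
      Complex.ofReal_im, zero_mul, add_zero]
    linear_combination s * hp2 + t * hq2 + a.im * e3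
  · have : crossProd (a - b) (s • p + t • q - b) = s * P + t * Q := by
      obtain rfl : s = 1 - t := by linarith
      simp only [hP, hQ, crossProd, Complex.add_im, Complex.real_smul, Complex.mul_im,
        Complex.ofReal_re, Complex.ofReal_im, zero_mul, add_zero, Complex.add_re, Complex.mul_re,
        sub_zero, Complex.sub_re, Complex.sub_im]
      ring
    rw [this]
    refine mul_left_cancel₀ h4.ne' ?_
    linear_combination P * e4 + Q * e5

/-- Disjoint segments with nested height ranges: both ends of the inner one lie on the same side
of the outer one. -/
theorem crossProd_pos_iff_of_nested {a b c d : ℂ} (h1 : c.im < a.im) (h2 : d.im < c.im)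
    (h3 : b.im < d.im) (h : ∀ z, z ∉ segment ℝ a b ∩ segment ℝ c d) :
    0 < crossProd (a - b) (c - b) ↔ 0 < crossProd (a - b) (d - b) := by
  have hc := left_mem_segment ℝ c d
  have hd := right_mem_segment ℝ c d
  constructor <;> intro h4 <;> by_contra! h5
  · obtain ⟨z, hz⟩ := segments_inter_of_crossProd (by linarith) hc hd (by linarith) (by linarith)
      (by linarith) (by linarith) h4.le h5
    exact h z hz
  · obtain ⟨z, hz⟩ := segments_inter_of_crossProd (by linarith) hd hc (by linarith) (by linarith)
      (by linarith) (by linarith) h4.le h5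
    exact h z hz

/-- Disjoint segments with interleaved height ranges: exactly one of the two inner ends lies to
the left of the other segment. -/
theorem crossProd_pos_iff_of_interleaved {a b c d : ℂ} (h1 : c.im < a.im) (h2 : b.im < c.im)
    (h3 : d.im < b.im) (h : ∀ z, z ∉ segment ℝ a b ∩ segment ℝ c d) :
    0 < crossProd (a - b) (c - b) ↔ ¬ 0 < crossProd (c - d) (b - d) := by
  have hcd : 0 < c.im - d.im := by linarith
  have hab : 0 < a.im - b.im := by linarith
  have hc := left_mem_segment ℝ c d
  set t : ℝ := (b.im - d.im) / (c.im - d.im) with ht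
  set w : ℂ := d + t • (c - d) with hw
  have ht' : t * (c.im - d.im) = b.im - d.im := by rw [ht]; field_simp
  have hwmem : w ∈ segment ℝ c d := by
    rw [segment_symm, segment_eq_image']
    exact ⟨t, ⟨div_nonneg (by linarith) hcd.le, (div_le_one hcd).2 (by linarith)⟩, rfl⟩
  have hwim : w.im = b.im := by
    simp only [hw, Complex.add_im, Complex.real_smul, Complex.mul_im, Complex.ofReal_re,
      Complex.ofReal_im, Complex.sub_im, zero_mul, add_zero]
    linarith
  have hwD : crossProd (a - b) (w - b) * (c.im - d.im) =
      -((a.im - b.im) * crossProd (c - d) (b - d)) := by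
    have hwre : w.re = d.re + t * (c.re - d.re) := by
      simp [hw]
    simp only [crossProd, Complex.sub_re, Complex.sub_im, hwim, hwre]
    linear_combination (-(a.im - b.im) * (c.re - d.re)) * ht'
  constructor
  · intro h4 h5
    have h6 : crossProd (a - b) (w - b) ≤ 0 := by
      by_contra! h6
      have := mul_pos h6 hcd
      have := mul_pos hab h5
      linarith
    obtain ⟨z, hz⟩ := segments_inter_of_crossProd (by linarith) hc hwmem (by linarith)
      (by linarith) (by linarith) (by linarith) h4.le h6
    exact h z hz
  · intro h5
    by_contra! h4
    push Not at h5
    have h6 : 0 ≤ crossProd (a - b) (w - b) := by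
      by_contra! h6
      have := mul_neg_of_neg_of_pos h6 hcd
      have := mul_nonpos_of_nonneg_of_nonpos hab.le h5
      linarith
    obtain ⟨z, hz⟩ := segments_inter_of_crossProd (by linarith) hwmem hc (by linarith)
      (by linarith) (by linarith) (by linarith) h6 h4
    exact h z hz

end PlaneGeometry

section PlanarPairs

/-- The point `v` lies strictly to the left of the upward segment from `b` to `a`. -/
def LeftOf (a b v : ℂ) : Prop := b.im < v.im ∧ v.im < a.im ∧ 0 < crossProd (a - b) (v - b)

/-- Darts, given by their head and tail, are ordered by decreasing height of their head and then
by decreasing direction. -/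
def DartLT (h t h' t' : ℂ) : Prop := h'.im < h.im ∨ h = h' ∧ (t' - h').arg < (t - h).arg

open scoped Classical in
/-- The indicator of a proposition, modulo two. -/
noncomputable def parity (p : Prop) : ZMod 2 := if p then 1 else 0

theorem parity_of {p : Prop} (h : p) : parity p = 1 := by simp [parity, h]

theorem parity_of_not {p : Prop} (h : ¬ p) : parity p = 0 := by simp [parity, h]

theorem parity_add_not {p q : Prop} (h : p ↔ ¬ q) : parity p + parity q = 1 := by
  by_cases hq : q
  · rw [parity_of hq, parity_of_not (fun hp => h.1 hp hq), zero_add]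
  · rw [parity_of_not hq, parity_of (h.2 hq), add_zero]

theorem parity_add_self (p : Prop) : parity p + parity p = 0 := CharTwo.add_self_eq_zero _

theorem parity_leftOf_pair {V : Type*} {G : SimpleGraph V} {pos : V → ℂ}
    (him : Function.Injective fun v => (pos v).im)
    (hvert : ∀ a b u : V, G.Adj a b → u ≠ a → u ≠ b → pos u ∉ segment ℝ (pos a) (pos b))
    (hcross : ∀ a b c d : V, G.Adj a b → G.Adj c d → (s(a, b) : Sym2 V) ≠ s(c, d) →
      ∀ z ∈ segment ℝ (pos a) (pos b) ∩ segment ℝ (pos c) (pos d),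
        ∃ u : V, (u = a ∨ u = b) ∧ (u = c ∨ u = d) ∧ z = pos u)
    {a b c d : V} (hab : G.Adj a b) (hcd : G.Adj c d) (h1 : (pos b).im < (pos a).im)
    (h2 : (pos d).im < (pos c).im) (hne : ¬ (a = c ∧ b = d))
    (hlt : DartLT (pos a) (pos b) (pos c) (pos d)) :
    parity (LeftOf (pos a) (pos b) (pos c)) + parity (LeftOf (pos a) (pos b) (pos d)) +
      (parity (LeftOf (pos c) (pos d) (pos a)) + parity (LeftOf (pos c) (pos d) (pos b))) =
    parity (DartLT (pos c) (pos d) (pos b) (pos a) ∧ DartLT (pos b) (pos a) (pos d) (pos c)) +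
      (parity (a = c) + parity (b = d)) := by
  have heq : ∀ {u v : V}, pos u = pos v ↔ u = v := fun {u v} =>
    ⟨fun h => him (congrArg Complex.im h), fun h => h ▸ rfl⟩
  have hneim : ∀ {u v : V}, u ≠ v → (pos u).im ≠ (pos v).im := fun h h' => h (him h')
  by_cases hac : a = c
  · subst hac
    have hbd : b ≠ d := fun h => hne ⟨rfl, h⟩
    have harg : (pos d - pos a).arg < (pos b - pos a).arg := by
      rcases hlt with h | h
      · exact absurd h (lt_irrefl _)
      · exact h.2
    rw [arg_lt_arg_iff_of_im_neg (p := pos d - pos a) (q := pos b - pos a)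
      (by simpa using h2) (by simpa using h1)] at harg
    have hL1 : ¬ LeftOf (pos a) (pos b) (pos a) := fun h => lt_irrefl _ h.2.1
    have hL2 : ¬ LeftOf (pos a) (pos d) (pos a) := fun h => lt_irrefl _ h.2.1
    rw [parity_of_not hL1, parity_of_not hL2, parity_of (rfl : a = a), parity_of_not hbd]
    rcases lt_or_gt_of_ne (hneim hbd) with h | h
    · have hL3 : LeftOf (pos a) (pos b) (pos d) := by
        refine ⟨h, h2, ?_⟩
        simp only [crossProd, Complex.sub_re, Complex.sub_im] at harg ⊢
        linarith
      have hL4 : ¬ LeftOf (pos a) (pos d) (pos b) := fun h' => lt_asymm h h'.1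
      have hX : ¬ DartLT (pos b) (pos a) (pos d) (pos a) := by
        rintro (h' | h')
        · exact lt_asymm h h'
        · exact hbd (heq.1 h'.1)
      rw [parity_of hL3, parity_of_not hL4, parity_of_not (fun h' => hX h'.2)]
      simp
    · have hL3 : ¬ LeftOf (pos a) (pos b) (pos d) := fun h' => lt_asymm h h'.1
      have hL4 : ¬ LeftOf (pos a) (pos d) (pos b) := by
        rintro ⟨_, _, h'⟩
        simp only [crossProd, Complex.sub_re, Complex.sub_im] at harg h'
        linarith
      rw [parity_of_not hL3, parity_of_not hL4, parity_of ⟨Or.inl h1, Or.inl h⟩]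
      decide
  · have hac' : (pos c).im < (pos a).im := by
      rcases hlt with h | h
      · exact h
      · exact absurd (heq.1 h.1) hac
    have hL1 : ¬ LeftOf (pos c) (pos d) (pos a) := fun h => lt_asymm hac' h.2.1
    rw [parity_of_not hL1, parity_of_not hac]
    rcases le_or_gt (pos c).im (pos b).im with hcb | hcb
    · have hbd : b ≠ d := by rintro rfl; exact absurd h2 (not_lt.2 hcb)
      have hL2 : ¬ LeftOf (pos a) (pos b) (pos c) := fun h => absurd h.1 (not_lt.2 hcb)
      have hL3 : ¬ LeftOf (pos a) (pos b) (pos d) := fun h => by have := h.1; linarith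
      have hL4 : ¬ LeftOf (pos c) (pos d) (pos b) := fun h => absurd h.2.1 (not_lt.2 hcb)
      have hX : ¬ DartLT (pos c) (pos d) (pos b) (pos a) := by
        rintro (h | ⟨h, h'⟩)
        · exact absurd h (not_lt.2 hcb)
        · have e1 : (pos d - pos c).arg < 0 := Complex.arg_neg_iff.2 (by simp; linarith)
          have e2 : 0 ≤ (pos a - pos b).arg := Complex.arg_nonneg_iff.2 (by simp; linarith)
          linarith
      rw [parity_of_not hL2, parity_of_not hL3, parity_of_not hL4, parity_of_not hbd,
        parity_of_not (fun h => hX h.1)]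
      decide
    · have hX1 : DartLT (pos c) (pos d) (pos b) (pos a) := Or.inl hcb
      have hcb' : c ≠ b := by rintro rfl; exact lt_irrefl _ hcb
      by_cases hbd : b = d
      · subst hbd
        have hL2 : ¬ LeftOf (pos a) (pos b) (pos b) := fun h => lt_irrefl _ h.1
        have hL3 : ¬ LeftOf (pos c) (pos b) (pos b) := fun h => lt_irrefl _ h.1
        have hX : parity (LeftOf (pos a) (pos b) (pos c)) +
            parity (DartLT (pos c) (pos b) (pos b) (pos a) ∧
              DartLT (pos b) (pos a) (pos b) (pos c)) = 1 := by
          apply parity_add_not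
          rw [and_iff_right hX1]
          simp only [true_and, LeftOf, hcb, hac', DartLT, lt_irrefl, false_or]
          rw [arg_lt_arg_iff_of_im_pos (p := pos c - pos b) (q := pos a - pos b)
            (by simpa using hcb) (by simpa using h1),
            crossProd_swap (pos c - pos b)]
          have h0 : crossProd (pos a - pos b) (pos c - pos b) ≠ 0 := fun h =>
            hvert a b c hab (Ne.symm hac) hcb'
              (mem_segment_of_crossProd_eq_zero h1 hcb.le hac'.le h)
          constructor
          · intro h; linarith
          · intro h
            exact lt_of_le_of_ne (by linarith) h0.symm
        rw [parity_of_not hL2, parity_of_not hL3, parity_of (rfl : b = b), ← hX]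
        linear_combination -parity_add_self (DartLT (pos c) (pos b) (pos b) (pos a) ∧
              DartLT (pos b) (pos a) (pos b) (pos c))
      · have hda : d ≠ a := by rintro rfl; linarith
        have hdisj : ∀ z, z ∉ segment ℝ (pos a) (pos b) ∩ segment ℝ (pos c) (pos d) := by
          intro z hz
          have hs : (s(a, b) : Sym2 V) ≠ s(c, d) := by
            intro h
            rcases Sym2.eq_iff.1 h with h | h
            · exact hac h.1
            · exact hcb' h.2.symm
          obtain ⟨u, rfl | rfl, rfl | rfl, _⟩ := hcross a b c d hab hcd hs z hz
          · exact hac rfl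
          · exact hda rfl
          · exact hcb' rfl
          · exact hbd rfl
        rw [parity_of_not hbd]
        rcases lt_or_gt_of_ne (hneim hbd) with h | h
        · have hL2 : ¬ LeftOf (pos c) (pos d) (pos b) := fun h' => lt_asymm h h'.1
          have hX : ¬ DartLT (pos b) (pos a) (pos d) (pos c) := by
            rintro (h' | h')
            · exact lt_asymm h h'
            · exact hbd (heq.1 h'.1)
          have hL : LeftOf (pos a) (pos b) (pos c) ↔ LeftOf (pos a) (pos b) (pos d) := by
            simp only [LeftOf, hcb, hac', h, h2.trans hac', true_and]
            exact crossProd_pos_iff_of_nested hac' h2 h hdisj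
          have hX' : ¬ (DartLT (pos c) (pos d) (pos b) (pos a) ∧
              DartLT (pos b) (pos a) (pos d) (pos c)) := fun h => hX h.2
          rw [parity_of_not hL2, parity_of_not hX', hL, parity_add_self]
        · have hL2 : ¬ LeftOf (pos a) (pos b) (pos d) := fun h' => lt_asymm h h'.1
          have hX : DartLT (pos b) (pos a) (pos d) (pos c) := Or.inl h
          have hL : parity (LeftOf (pos a) (pos b) (pos c)) +
              parity (LeftOf (pos c) (pos d) (pos b)) = 1 := by
            apply parity_add_not
            simp only [LeftOf, hcb, hac', h, true_and]
            exact crossProd_pos_iff_of_interleaved hac' hcb h hdisj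
          have hX' : DartLT (pos c) (pos d) (pos b) (pos a) ∧
              DartLT (pos b) (pos a) (pos d) (pos c) := ⟨hX1, hX⟩
          rw [parity_of_not hL2, parity_of hX']
          linear_combination hL

end PlanarPairs

section Counting

theorem Finset.sum_sum_eq_sum_sum_lt_add {H M : Type*} [LinearOrder H] [AddCommMonoid M]
    (S : Finset H) (f : H → H → M) :
    ∑ n ∈ S, ∑ m ∈ S, f n m =
      (∑ n ∈ S, ∑ m ∈ S, if n < m then f n m + f m n else 0) + ∑ n ∈ S, f n n := by
  have h1 : ∀ n m : H, f n m =
      (if n < m then f n m else 0) + (if m < n then f n m else 0) + if n = m then f n m else 0 := by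
    intro n m
    rcases lt_trichotomy n m with h | rfl | h
    · simp [h, h.not_gt, h.ne]
    · simp
    · simp [h, h.not_gt, h.ne']
  have h2 : ∑ n ∈ S, ∑ m ∈ S, (if n = m then f n m else 0) = ∑ n ∈ S, f n n := by
    refine Finset.sum_congr rfl fun n hn => ?_
    rw [Finset.sum_ite_eq, if_pos hn]
  have h3 : ∑ n ∈ S, ∑ m ∈ S, (if n < m then f n m + f m n else 0) =
      ∑ n ∈ S, ∑ m ∈ S, ((if n < m then f n m else 0) + if n < m then f m n else 0) := by
    refine Finset.sum_congr rfl fun n _ => Finset.sum_congr rfl fun m _ => ?_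
    split_ifs <;> simp
  rw [Finset.sum_congr rfl fun n _ => Finset.sum_congr rfl fun m _ => h1 n m, h3]
  simp only [Finset.sum_add_distrib]
  rw [h2, Finset.sum_comm (f := fun n m => if m < n then f n m else 0)]

theorem Finset.sum_sum_ite_eq_sum_card_mul_card {H V : Type*} [Fintype V] [DecidableEq V]
    (S : Finset H) (t : H → V) :
    ∑ n ∈ S, ∑ m ∈ S, (if t n = t m then 1 else 0) =
      ∑ v, (S.filter fun h => t h = v).card * (S.filter fun h => t h = v).card := by
  rw [← Finset.sum_fiberwise S t]
  refine Finset.sum_congr rfl fun v _ => ?_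
  rw [← smul_eq_mul, ← Finset.sum_const]
  refine Finset.sum_congr rfl fun n hn => ?_
  rw [(Finset.mem_filter.1 hn).2, Finset.card_filter]
  exact Finset.sum_congr rfl fun m _ => by simp only [eq_comm]

/-- If every vertex is the top or the bottom of an even number of elements of `S`, then the pairs
of elements sharing a top or a bottom are even in number. -/
theorem sum_parity_shared_ends {H V : Type*} [LinearOrder H] [Fintype V] [DecidableEq V]
    (S : Finset H) (t b : H → V)
    (h : ∀ v, Even ((S.filter fun h => t h = v).card + (S.filter fun h => b h = v).card)) :
    ∑ n ∈ S, ∑ m ∈ S, (if n < m then parity (t n = t m) + parity (b n = b m) else 0) = 0 := by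
  set E : ℕ := ∑ n ∈ S, ∑ m ∈ S, if n < m then
    (if t n = t m then 1 else 0) + (if b n = b m then 1 else 0) else 0 with hE
  have h1 : ∑ n ∈ S, ∑ m ∈ S, (if n < m then parity (t n = t m) + parity (b n = b m) else 0) =
      (E : ZMod 2) := by
    rw [hE]
    push_cast
    refine Finset.sum_congr rfl fun n _ => Finset.sum_congr rfl fun m _ => ?_
    simp only [parity]
    congr
  have h2 := Finset.sum_sum_eq_sum_sum_lt_add S
    fun n m => (if t n = t m then 1 else 0) + (if b n = b m then 1 else 0)
  have h3 : ∑ n ∈ S, ∑ m ∈ S, (if n < m then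
      ((if t n = t m then 1 else 0) + (if b n = b m then 1 else 0)) +
      ((if t m = t n then 1 else 0) + (if b m = b n then 1 else 0)) else 0) = 2 * E := by
    rw [hE, Finset.mul_sum]
    refine Finset.sum_congr rfl fun n _ => ?_
    rw [Finset.mul_sum]
    refine Finset.sum_congr rfl fun m _ => ?_
    simp only [eq_comm (a := t m), eq_comm (a := b m), two_mul]
    split_ifs <;> rfl
  rw [h3] at h2
  simp only [Finset.sum_add_distrib, Finset.sum_sum_ite_eq_sum_card_mul_card, if_true,
    Finset.sum_const, smul_eq_mul, mul_one] at h2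
  have h4 : S.card = ∑ v, (S.filter fun h => b h = v).card := by
    simp only [Finset.card_eq_sum_ones, Finset.sum_fiberwise]
  have h5 : (4 : ℤ) ∣ ∑ v, (((S.filter fun h => t h = v).card : ℤ) ^ 2 +
      ((S.filter fun h => b h = v).card : ℤ) ^ 2 - 2 * ((S.filter fun h => b h = v).card : ℤ)) := by
    refine Finset.dvd_sum fun v _ => ?_
    obtain ⟨k, hk⟩ := h v
    have hk' : ((S.filter fun h => t h = v).card : ℤ) =
      k + k - (S.filter fun h => b h = v).card := by omega
    rw [hk']
    obtain ⟨l, hl⟩ := Int.even_mul_pred_self ((S.filter fun h => b h = v).card : ℤ)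
    generalize ((S.filter fun h => b h = v).card : ℤ) = x at *
    exact ⟨k * k - k * x + l, by linear_combination 2 * hl⟩
  have h6 : ∑ v, (((S.filter fun h => t h = v).card : ℤ) ^ 2 +
      ((S.filter fun h => b h = v).card : ℤ) ^ 2 - 2 * ((S.filter fun h => b h = v).card : ℤ)) =
      2 * (E : ℤ) := by
    have h2' : (∑ v, ((S.filter fun h => t h = v).card : ℤ) * (S.filter fun h => t h = v).card) +
        ∑ v, ((S.filter fun h => b h = v).card : ℤ) * (S.filter fun h => b h = v).card =
        2 * E + (S.card + S.card) := by exact_mod_cast h2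
    have h4' : (S.card : ℤ) = ∑ v, ((S.filter fun h => b h = v).card : ℤ) := by exact_mod_cast h4
    rw [Finset.sum_sub_distrib, Finset.sum_add_distrib, ← Finset.mul_sum, ← h4']
    simp only [pow_two]
    linarith
  rw [h1, ZMod.natCast_eq_zero_iff_even]
  rw [h6] at h5
  rw [← Int.even_coe_nat, even_iff_two_dvd]
  omega

theorem EvenAt.sum_eq_zero {H V : Type*} [Fintype V] [DecidableEq V] {head : H → V} {U : Finset H}
    (hU : EvenAt head U) (g : V → ZMod 2) : ∑ h ∈ U, g (head h) = 0 := by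
  rw [← Finset.sum_fiberwise U head]
  refine Finset.sum_eq_zero fun v _ => ?_
  have : ∀ h ∈ U.filter (fun h => head h = v), g (head h) = g v := fun h hh => by
    rw [(Finset.mem_filter.1 hh).2]
  rw [Finset.sum_congr rfl this, Finset.sum_const, nsmul_eq_mul,
    (ZMod.natCast_eq_zero_iff_even).2 (hU v), zero_mul]

theorem sum_add_sum_invol {H M : Type*} [LinearOrder H] [AddCommMonoid M] {ι : H → H}
    (hι : Function.Involutive ι) (hne : ∀ h, ι h ≠ h) {U : Finset H} (hU : ∀ h ∈ U, ι h ∈ U)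
    (F : H → M) :
    ∑ m ∈ U.filter (fun h => h < ι h), (F m + F (ι m)) = ∑ h ∈ U, F h := by
  rw [Finset.sum_add_distrib, ← Finset.sum_filter_add_sum_filter_not U (fun h => h < ι h)]
  congr 1
  refine Finset.sum_nbij' ι ι ?_ ?_ (fun h _ => hι h) (fun h _ => hι h) (fun h _ => rfl)
  · intro h hh
    rw [Finset.mem_filter] at hh ⊢
    exact ⟨hU h hh.1, by rw [hι]; exact hh.2.not_gt⟩
  · intro h hh
    rw [Finset.mem_filter] at hh ⊢
    refine ⟨hU h hh.1, ?_⟩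
    rw [hι]
    exact lt_of_le_of_ne (not_lt.1 hh.2) (hne h)

/-- In a planar drawing, an even set of edges has an even number of crossing chords. -/
theorem crossingSign_eq_one (R : Type*) [CommRing R] {V : Type*} [Fintype V] [DecidableEq V]
    {G : SimpleGraph V} {pos : V → ℂ}
    (him : Function.Injective fun v => (pos v).im)
    (hvert : ∀ a b u : V, G.Adj a b → u ≠ a → u ≠ b → pos u ∉ segment ℝ (pos a) (pos b))
    (hcross : ∀ a b c d : V, G.Adj a b → G.Adj c d → (s(a, b) : Sym2 V) ≠ s(c, d) →
      ∀ z ∈ segment ℝ (pos a) (pos b) ∩ segment ℝ (pos c) (pos d),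
        ∃ u : V, (u = a ∨ u = b) ∧ (u = c ∨ u = d) ∧ z = pos u)
    {H : Type*} [LinearOrder H] {ι : H → H} (hι : Function.Involutive ι) (hne : ∀ h, ι h ≠ h)
    {head tail : H → V} (hhead : ∀ h, head (ι h) = tail h) (hadj : ∀ h, G.Adj (head h) (tail h))
    (hdart : ∀ e f, head e = head f → tail e = tail f → e = f)
    (hlt : ∀ e f, e < f ↔
      DartLT (pos (head e)) (pos (tail e)) (pos (head f)) (pos (tail f)))
    {U : Finset H} (hU : ∀ h ∈ U, ι h ∈ U) (heven : EvenAt head U) :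
    crossingSign R ι U = 1 := by
  have htail : ∀ h, tail (ι h) = head h := fun h => by rw [← hhead, hι]
  have hup : ∀ h, h < ι h → (pos (tail h)).im < (pos (head h)).im := by
    intro h hh
    rw [hlt, hhead, htail] at hh
    rcases hh with hh | hh
    · exact hh
    · exact absurd (him (congrArg Complex.im hh.1)) (hadj h).ne
  set S := U.filter fun h => h < ι h with hS
  let P : H → H → Prop := fun n m => n < m ∧ m < ι n ∧ ι n < ι m
  have h1 : crossingSign R ι U = (-1) ^ ∑ n ∈ U, ∑ m ∈ U, (if P n m then 1 else 0) := by
    simp only [crossingSign, crossSign, ← Finset.prod_pow_eq_pow_sum]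
    refine Finset.prod_congr rfl fun n _ => Finset.prod_congr rfl fun m _ => ?_
    simp only [P]
    split_ifs <;> simp
  rw [h1]
  apply Even.neg_one_pow
  rw [← ZMod.natCast_eq_zero_iff_even]
  have h2 : ((∑ n ∈ U, ∑ m ∈ U, (if P n m then 1 else 0) : ℕ) : ZMod 2) =
      ∑ n ∈ S, ∑ m ∈ S, if n < m then parity (m < ι n ∧ ι n < ι m) else 0 := by
    push_cast
    rw [hS, Finset.sum_filter]
    refine Finset.sum_congr rfl fun n _ => ?_
    rw [Finset.sum_filter]
    split_ifs with hn
    · refine Finset.sum_congr rfl fun m _ => ?_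
      by_cases h3 : P n m
      · have h4 : m < ι m := h3.2.1.trans h3.2.2
        rw [if_pos h3, if_pos h4, if_pos h3.1, parity_of h3.2]
      · rw [if_neg h3]
        split_ifs with h4 h5
        · rw [parity_of_not fun h6 => h3 ⟨h5, h6⟩]
        · rfl
        · rfl
    · refine Finset.sum_eq_zero fun m _ => if_neg fun h3 => hn (h3.1.trans h3.2.1)
  let L : H → V → ZMod 2 := fun n v => parity (LeftOf (pos (head n)) (pos (tail n)) (pos v))
  have h3 : ∑ n ∈ S, ∑ m ∈ S, (L n (head m) + L n (tail m)) = 0 := by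
    refine Finset.sum_eq_zero fun n _ => ?_
    rw [← heven.sum_eq_zero (L n), ← sum_add_sum_invol hι hne hU]
    simp only [hhead]
    rfl
  have h4 : ∀ n, L n (head n) + L n (tail n) = 0 := by
    intro n
    simp only [L]
    rw [parity_of_not fun h => lt_irrefl _ h.2.1, parity_of_not fun h => lt_irrefl _ h.1, add_zero]
  rw [Finset.sum_sum_eq_sum_sum_lt_add, Finset.sum_congr rfl fun n _ => h4 n,
    Finset.sum_const_zero, add_zero] at h3
  have h5 : ∑ n ∈ S, ∑ m ∈ S,
      (if n < m then parity (head n = head m) + parity (tail n = tail m) else 0) = 0 := by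
    apply sum_parity_shared_ends
    intro v
    have h6 := heven v
    rw [Finset.card_filter, ← sum_add_sum_invol hι hne hU, Finset.sum_add_distrib] at h6
    simpa only [hhead, Finset.card_filter] using h6
  rw [h2]
  have h6 : ∀ n ∈ S, ∀ m ∈ S, (if n < m then parity (m < ι n ∧ ι n < ι m) else 0) +
      (if n < m then parity (head n = head m) + parity (tail n = tail m) else 0) =
      if n < m then L n (head m) + L n (tail m) + (L m (head n) + L m (tail n)) else 0 := by
    intro n hn m hm
    split_ifs with hnm
    · simp only [L]
      have e1 : m < ι n ↔ DartLT (pos (head m)) (pos (tail m)) (pos (tail n)) (pos (head n)) := by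
        rw [hlt, hhead, htail]
      have e2 : ι n < ι m ↔
          DartLT (pos (tail n)) (pos (head n)) (pos (tail m)) (pos (head m)) := by
        rw [hlt, hhead, htail, hhead, htail]
      rw [e1, e2]
      exact (parity_leftOf_pair him hvert hcross (hadj n) (hadj m)
        (hup n (Finset.mem_filter.1 hn).2) (hup m (Finset.mem_filter.1 hm).2)
        (fun h => hnm.ne (hdart n m h.1 h.2)) ((hlt n m).1 hnm)).symm
    · simp
  have h7 := Finset.sum_congr rfl fun n hn => Finset.sum_congr rfl fun m hm => h6 n hn m hm
  simp only [Finset.sum_add_distrib] at h7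
  rw [h5, add_zero] at h7
  exact h7.trans h3

end Counting

theorem exp_half_arg_div_neg {p q : ℂ} (hp : p.im ≠ 0) (hq : q ≠ 0) (hpq : p.arg ≠ q.arg) :
    Complex.exp (Complex.I / 2 * (q / -p).arg) * Complex.exp (Complex.I / 2 * (-p).arg) =
      (if p.im < 0 then -1 else 1) * (if q.arg < p.arg then 1 else -1) *
        Complex.exp (Complex.I / 2 * q.arg) := by
  have hp0 := ne_zero_of_im_ne_zero hp
  have key : ∀ ε : ℝ, (ε = 1 ∨ ε = -1) → -Real.pi < q.arg - p.arg + ε * Real.pi →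
      q.arg - p.arg + ε * Real.pi ≤ Real.pi → (q / -p).arg = q.arg - p.arg + ε * Real.pi := by
    intro ε hε h1 h2
    rw [← Complex.arg_coe_angle_toReal_eq_arg, Complex.arg_div_coe_angle hq (neg_ne_zero.2 hp0),
      Complex.arg_neg_coe_angle hp0, ← Real.Angle.toReal_coe_eq_self_iff.2 ⟨h1, h2⟩]
    congr 1
    rw [Real.Angle.coe_add, Real.Angle.coe_sub, ← sub_sub]
    rcases hε with rfl | rfl
    · rw [one_mul, Real.Angle.sub_coe_pi_eq_add_coe_pi]
    · rw [neg_one_mul, Real.Angle.coe_neg, sub_eq_add_neg]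
  have b1 := Complex.neg_pi_lt_arg p
  have b2 := Complex.neg_pi_lt_arg q
  have b3 := Complex.arg_le_pi p
  have b4 := Complex.arg_le_pi q
  have e1 : Complex.exp (Complex.I / 2 * q.arg + Complex.I * Real.pi) =
      -Complex.exp (Complex.I / 2 * q.arg) := by
    rw [mul_comm Complex.I, Complex.exp_add_pi_mul_I]
  have e2 : Complex.exp (Complex.I / 2 * q.arg - Complex.I * Real.pi) =
      -Complex.exp (Complex.I / 2 * q.arg) := by
    rw [mul_comm Complex.I, Complex.exp_sub_pi_mul_I]
  rw [← Complex.exp_add]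
  rcases lt_or_gt_of_ne hp with h1 | h1 <;> rcases lt_or_gt_of_ne hpq with h2 | h2
  · rw [key (-1) (Or.inr rfl) (by linarith) (by linarith),
      Complex.arg_neg_eq_arg_add_pi_of_im_neg h1, if_pos h1, if_neg h2.not_gt,
      show (-1 : ℂ) * -1 = 1 by norm_num, one_mul]
    congr 1
    push_cast
    ring
  · rw [key 1 (Or.inl rfl) (by linarith) (by linarith),
      Complex.arg_neg_eq_arg_add_pi_of_im_neg h1, if_pos h1, if_pos h2, mul_one,
      neg_one_mul (Complex.exp _), ← e1]
    congr 1
    push_cast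
    ring
  · rw [key (-1) (Or.inr rfl) (by linarith) (by linarith),
      Complex.arg_neg_eq_arg_sub_pi_of_im_pos h1, if_neg h1.not_gt, if_neg h2.not_gt, one_mul,
      neg_one_mul (Complex.exp _), ← e2]
    congr 1
    push_cast
    ring
  · rw [key 1 (Or.inl rfl) (by linarith) (by linarith),
      Complex.arg_neg_eq_arg_sub_pi_of_im_pos h1, if_neg h1.not_gt, if_pos h2,
      one_mul (1 : ℂ), one_mul (Complex.exp _)]
    congr 1
    push_cast
    ring

/-- A matrix of Kac-Ward type, with phases compatible with a linear order on the darts, has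
determinant the square of `pfSum`. -/
theorem det_eq_pfSum_sq {R : Type*} [CommRing R] [IsDomain R] {K : Type*} [CommRing K]
    [Nontrivial K] (φ : R →+* K) {H V : Type*} [Fintype H] [LinearOrder H] [DecidableEq V]
    {ι : H → H} (hι : Function.Involutive ι) (hne : ∀ h, ι h ≠ h) {vert : H → V}
    (hconv : ∀ a b h : H, a < h → h < b → vert a = vert b → vert h = vert a)
    (hloop : ∀ h, vert (ι h) ≠ vert h)
    {z : H → R} (hφ : ∀ h, φ (z h) = 0) (hz : ∀ h, z (ι h) = z h)
    {ω : H → R} (hω : ∀ h, ω h ≠ 0) {τ : H → H → R}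
    (hτ : ∀ e e', vert (ι e') = vert e → e' ≠ ι e →
      τ e e' * ω e = -ordSign R e (ι e) * ordSign R e (ι e') * ω e')
    {N : Matrix H H R} (hN : ∀ e e', N e e' = if e' = e then 1 else
      if vert (ι e') = vert e ∧ e' ≠ ι e then -(τ e e' * z e ^ 2) else 0) :
    N.det = pfSum ι vert z Finset.univ ^ 2 := by
  let T : Matrix H H R := Matrix.of fun e e' =>
    if vert (ι e') = vert e ∧ e' ≠ ι e then τ e e' else 0
  let D : Matrix H H R := Matrix.diagonal z
  let s : H → R := fun e => ordSign R e (ι e)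
  have hN' : N = 1 - D * (D * T) := by
    ext e e'
    rw [hN, Matrix.sub_apply, Matrix.diagonal_mul, Matrix.diagonal_mul, Matrix.one_apply]
    simp only [T, Matrix.of_apply, eq_comm (a := e)]
    by_cases h : e' = e
    · subst h
      simp [hloop]
    · rw [if_neg h, if_neg h]
      split_ifs <;> ring
  rw [hN', Matrix.det_one_sub_mul_comm]
  set N₂ : Matrix H H R := 1 - D * T * D with hN₂
  let σ : Equiv.Perm H := hι.toPerm
  have hQ : Matrix.diagonal (fun e => ω e * s e) * N₂ =
      (pfMatrix ι vert z).submatrix id σ * Matrix.diagonal ω := by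
    ext e e'
    rw [Matrix.diagonal_mul, Matrix.mul_diagonal, Matrix.submatrix_apply, hN₂, Matrix.sub_apply,
      Matrix.mul_diagonal, Matrix.diagonal_mul, Matrix.one_apply]
    simp only [T, Matrix.of_apply, id, pfMatrix_apply, σ, Function.Involutive.coe_toPerm, pfWeight,
      hι.injective.eq_iff, hz, s]
    by_cases h : e = e'
    · subst h
      simp [hloop, (hne e).symm, mul_comm]
    · by_cases h2 : e = ι e'
      · have h3 : e' = ι e := by rw [h2, hι]
        rw [if_pos h2]
        simp [h3, (hne e).symm]
      · have h3 : e' ≠ ι e := fun h3 => h2 (by rw [h3, hι])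
        rw [if_neg h2, if_neg h, if_neg (Ne.symm h)]
        by_cases h4 : vert (ι e') = vert e
        · rw [if_pos ⟨h4, h3⟩, if_pos h4]
          linear_combination (-(ordSign R e (ι e) * z e * z e')) * hτ e e' h4 h3 +
            ordSign R e (ι e') * ω e' * z e * z e' * ordSign_mul_self (R := R) e (ι e)
        · rw [if_neg (fun h => h4 h.1), if_neg h4]
          ring
  have hQ0 : (pfMatrix ι vert (0 : H → R)).submatrix id σ = Matrix.diagonal s := by
    ext e e'
    rw [Matrix.submatrix_apply]
    simp only [id, pfMatrix_apply, σ, Function.Involutive.coe_toPerm, pfWeight,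
      hι.injective.eq_iff, Pi.zero_apply, mul_zero, ite_self, add_zero, s]
    by_cases h : e = e'
    · subst h
      simp [(hne e).symm]
    · simp [h, Ne.symm h]
  have h1 := congrArg Matrix.det hQ
  have h2 := congrArg Matrix.det hQ0
  rw [Matrix.det_mul, Matrix.det_mul, Matrix.det_diagonal, Matrix.det_diagonal,
    Matrix.det_permute', det_pfMatrix φ hι hne hconv hφ, Finset.prod_mul_distrib] at h1
  rw [Matrix.det_permute', Matrix.det_diagonal] at h2
  have h3 : ∏ e, ω e ≠ 0 := Finset.prod_ne_zero_iff.2 fun e _ => hω e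
  have h4 : ∏ e, s e ≠ 0 := Finset.prod_ne_zero_iff.2 fun e _ h => by
    have := ordSign_mul_self (R := R) e (ι e)
    simp only [s] at h
    rw [h, zero_mul] at this
    exact zero_ne_one this
  refine mul_left_cancel₀ (mul_ne_zero h3 h4) ?_
  rw [h1]
  linear_combination (pfSum ι vert z Finset.univ ^ 2 * ∏ e, ω e) * h2

theorem mem_segment_of_arg_eq {h a b : ℂ} (ha : a ≠ h) (hb : b ≠ h)
    (harg : (a - h).arg = (b - h).arg) (hle : ‖b - h‖ ≤ ‖a - h‖) : b ∈ segment ℝ h a := by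
  rw [segment_eq_image']
  have h1 := (Complex.arg_eq_arg_iff (sub_ne_zero.2 ha) (sub_ne_zero.2 hb)).1 harg
  refine ⟨‖b - h‖ / ‖a - h‖, ⟨by positivity, div_le_one_of_le₀ hle (norm_nonneg _)⟩, ?_⟩
  simp only [Complex.real_smul]
  push_cast
  rw [h1]
  ring

theorem mem_segment_of_mul_mem_segment {c a b z : ℂ} (hc : c ≠ 0)
    (h : z ∈ segment ℝ (c * a) (c * b)) : c⁻¹ * z ∈ segment ℝ a b := by
  obtain ⟨s, t, hs, ht, hst, rfl⟩ := h
  refine ⟨s, t, hs, ht, hst, ?_⟩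
  simp only [Complex.real_smul]
  field_simp

theorem exists_mul_im_injective {V : Type*} [Fintype V] {pos : V → ℂ}
    (hinj : Function.Injective pos) :
    ∃ c : ℂ, c ≠ 0 ∧ Function.Injective fun v => (c * pos v).im := by
  classical
  obtain ⟨t, ht⟩ := Infinite.exists_notMem_finset
    ((Finset.univ : Finset (V × V)).image fun p =>
      -(pos p.1 - pos p.2).im / (pos p.1 - pos p.2).re)
  refine ⟨1 + t * Complex.I, ?_, ?_⟩
  · intro h
    simpa using congrArg Complex.re h
  · intro u v huv
    by_contra hne
    have h1 : pos u - pos v ≠ 0 := sub_ne_zero.2 fun h => hne (hinj h)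
    have h2 : (pos u - pos v).im + t * (pos u - pos v).re = 0 := by
      simp at huv ⊢
      linear_combination huv
    have h3 : (pos u - pos v).re ≠ 0 := by
      intro h3
      rw [h3, mul_zero, add_zero] at h2
      exact h1 (Complex.ext h3 h2)
    refine ht (Finset.mem_image.2 ⟨(u, v), Finset.mem_univ _, ?_⟩)
    rw [div_eq_iff h3]
    linear_combination -h2

section Darts

variable {V : Type*} (G : SimpleGraph V)

/-- The reversal of an oriented edge. -/
def dartRev (e : {p : V × V // G.Adj p.1 p.2}) : {p : V × V // G.Adj p.1 p.2} :=
  ⟨(e.1.2, e.1.1), e.2.symm⟩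

/-- The edge underlying an oriented edge. -/
def dartEdge (e : {p : V × V // G.Adj p.1 p.2}) : G.edgeSet :=
  ⟨s(e.1.1, e.1.2), G.mem_edgeSet.mpr e.2⟩

theorem dartRev_involutive : Function.Involutive (dartRev G) := fun _ => rfl

theorem dartRev_ne (e : {p : V × V // G.Adj p.1 p.2}) : dartRev G e ≠ e := fun h =>
  e.2.ne' (congrArg (fun e => e.1.1) h)

theorem dartEdge_rev (e : {p : V × V // G.Adj p.1 p.2}) :
    dartEdge G (dartRev G e) = dartEdge G e := Subtype.ext Sym2.eq_swap

theorem dartEdge_eq_iff {e f : {p : V × V // G.Adj p.1 p.2}} :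
    dartEdge G e = dartEdge G f ↔ e = f ∨ e = dartRev G f := by
  rw [dartEdge, dartEdge, Subtype.mk.injEq, Sym2.eq_iff, Subtype.ext_iff, Subtype.ext_iff,
    Prod.ext_iff, Prod.ext_iff]
  rfl

theorem dartEdge_surjective : Function.Surjective (dartEdge G) := by
  rintro ⟨f, hf⟩
  induction f using Sym2.ind with
  | _ a b => exact ⟨⟨(a, b), hf⟩, rfl⟩

variable [Fintype V] [DecidableEq V] [DecidableRel G.Adj]

theorem prod_dartEdge {R : Type*} [CommRing R] (z : G.edgeSet → R) (ξ : Finset G.edgeSet) :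
    ∏ h ∈ Finset.univ.filter (fun h => dartEdge G h ∈ ξ), z (dartEdge G h) = ∏ f ∈ ξ, z f ^ 2 := by
  rw [← Finset.prod_fiberwise_of_maps_to (t := ξ) (g := dartEdge G)
    fun h hh => (Finset.mem_filter.1 hh).2]
  refine Finset.prod_congr rfl fun f hf => ?_
  obtain ⟨h, rfl⟩ := dartEdge_surjective G f
  have : (Finset.univ.filter (fun h => dartEdge G h ∈ ξ)).filter
      (fun h' => dartEdge G h' = dartEdge G h) = {h, dartRev G h} := by
    ext h'
    simp only [Finset.mem_filter, Finset.mem_univ, true_and, Finset.mem_insert,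
      Finset.mem_singleton, ← dartEdge_eq_iff]
    exact ⟨fun h => h.2, fun h => ⟨h ▸ hf, h⟩⟩
  rw [this, Finset.prod_pair (dartRev_ne G h).symm, dartEdge_rev, pow_two]

theorem card_filter_dart_head (ξ : Finset G.edgeSet) (v : V) :
    ((Finset.univ.filter (fun h => dartEdge G h ∈ ξ)).filter fun h => h.1.2 = v).card =
      (ξ.filter fun f : G.edgeSet => v ∈ (f : Sym2 V)).card := by
  refine Finset.card_bij (fun h _ => dartEdge G h) ?_ ?_ ?_
  · intro h hh
    simp only [Finset.mem_filter, Finset.mem_univ, true_and] at hh ⊢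
    exact ⟨hh.1, hh.2 ▸ Sym2.mem_mk_right _ _⟩
  · intro h hh h' hh' heq
    simp only [Finset.mem_filter, Finset.mem_univ, true_and] at hh hh'
    rcases (dartEdge_eq_iff G).1 heq with h1 | h1
    · exact h1
    · subst h1
      exact absurd (hh.2.trans hh'.2.symm) h'.2.ne
  · rintro ⟨f, hf⟩ hh
    simp only [Finset.mem_filter] at hh
    obtain ⟨u, rfl⟩ := Sym2.mem_iff_exists.1 hh.2
    have hadj : G.Adj u v := (G.mem_edgeSet.1 hf).symm
    have h1 : dartEdge G ⟨(u, v), hadj⟩ = ⟨s(v, u), hf⟩ := Subtype.ext Sym2.eq_swap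
    refine ⟨⟨(u, v), hadj⟩, ?_, h1⟩
    simp only [Finset.mem_filter, Finset.mem_univ, true_and, and_true]
    rw [h1]
    exact hh.1

theorem sum_even_darts {R : Type*} [CommRing R] (z : G.edgeSet → R)
    {D : Finset (Finset {p : V × V // G.Adj p.1 p.2})}
    (hD : ∀ U, U ∈ D ↔ (∀ h ∈ U, dartRev G h ∈ U) ∧ EvenAt (fun h => h.1.2) U) :
    ∑ U ∈ D, ∏ h ∈ U, z (dartEdge G h) =
      ∑ ξ ∈ Finset.univ.filter
          (fun ξ : Finset G.edgeSet =>
            ∀ v : V, Even ((ξ.filter (fun f : G.edgeSet => v ∈ (f : Sym2 V))).card)),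
        ∏ f ∈ ξ, z f ^ 2 := by
  classical
  have hr : ∀ U ∈ D, Finset.univ.filter (fun h => dartEdge G h ∈ U.image (dartEdge G)) = U := by
    intro U hU
    ext h
    simp only [Finset.mem_filter, Finset.mem_univ, true_and, Finset.mem_image]
    constructor
    · rintro ⟨h', hh', h1⟩
      rcases (dartEdge_eq_iff G).1 h1.symm with rfl | rfl
      · exact hh'
      · exact ((hD U).1 hU).1 _ hh'
    · exact fun hh => ⟨h, hh, rfl⟩
  symm
  refine Finset.sum_nbij' (fun ξ => Finset.univ.filter (fun h => dartEdge G h ∈ ξ))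
    (fun U => U.image (dartEdge G)) ?_ ?_ ?_ hr ?_
  · intro ξ hξ
    rw [hD]
    refine ⟨fun h hh => ?_, fun v => ?_⟩
    · simpa [dartEdge_rev] using hh
    · have h1 := (Finset.mem_filter.1 hξ).2 v
      rwa [← card_filter_dart_head] at h1
  · intro U hU
    refine Finset.mem_filter.2 ⟨Finset.mem_univ _, fun v => ?_⟩
    rw [← card_filter_dart_head, hr U hU]
    exact ((hD U).1 hU).2 v
  · intro ξ _
    ext f
    obtain ⟨h, rfl⟩ := dartEdge_surjective G f
    simp only [Finset.mem_image, Finset.mem_filter, Finset.mem_univ, true_and]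
    exact ⟨fun ⟨h', hh', h1⟩ => h1 ▸ hh', fun hh => ⟨h, hh, rfl⟩⟩
  · intro ξ _
    exact (prod_dartEdge G z ξ).symm

end Darts

/-- In a drawing, distinct edges at a vertex leave it in distinct directions. -/
theorem arg_sub_ne_of_drawing {V : Type*} {G : SimpleGraph V} {pos : V → ℂ}
    (hinj : Function.Injective pos)
    (hvert : ∀ a b u : V, G.Adj a b → u ≠ a → u ≠ b → pos u ∉ segment ℝ (pos a) (pos b))
    {h a b : V} (ha : G.Adj h a) (hb : G.Adj h b) (hab : a ≠ b) :
    (pos a - pos h).arg ≠ (pos b - pos h).arg := by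
  intro harg
  rcases le_total ‖pos b - pos h‖ ‖pos a - pos h‖ with hle | hle
  · exact hvert h a b ha hb.ne' hab.symm
      (mem_segment_of_arg_eq (hinj.ne ha.ne') (hinj.ne hb.ne') harg hle)
  · exact hvert h b a hb ha.ne' hab
      (mem_segment_of_arg_eq (hinj.ne hb.ne') (hinj.ne ha.ne') harg.symm hle)

theorem exists_dart_order {V : Type*} {G : SimpleGraph V} {pos : V → ℂ}
    (him : Function.Injective fun v => (pos v).im)
    (hvert : ∀ a b u : V, G.Adj a b → u ≠ a → u ≠ b → pos u ∉ segment ℝ (pos a) (pos b)) :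
    ∃ _ : LinearOrder {p : V × V // G.Adj p.1 p.2}, ∀ e f : {p : V × V // G.Adj p.1 p.2}, e < f ↔
      DartLT (pos e.1.2) (pos e.1.1) (pos f.1.2) (pos f.1.1) := by
  let key : {p : V × V // G.Adj p.1 p.2} → ℝ ×ₗ ℝ := fun e =>
    toLex (-(pos e.1.2).im, -(pos e.1.1 - pos e.1.2).arg)
  have hinj : Function.Injective pos := fun u v h => him (congrArg Complex.im h)
  have hkey : Function.Injective key := by
    rintro ⟨⟨a, u⟩, ha⟩ ⟨⟨b, v⟩, hb⟩ h
    have h' := Prod.ext_iff.1 (toLex.injective h)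
    obtain rfl : u = v := him (neg_injective h'.1)
    by_contra hne
    exact arg_sub_ne_of_drawing hinj hvert ha.symm hb.symm (fun hab => hne (by subst hab; rfl))
      (neg_injective h'.2)
  refine ⟨LinearOrder.lift' key hkey, fun e f => ?_⟩
  change key e < key f ↔ _
  rw [Prod.Lex.toLex_lt_toLex, DartLT, neg_lt_neg_iff, neg_lt_neg_iff, neg_inj,
    him.eq_iff (a := e.1.2), hinj.eq_iff]

/-- The Kac-Ward formula for drawings in which the vertices have distinct heights. -/
theorem kac_ward_formula_of_injective_im
    {V : Type*} [Fintype V] [DecidableEq V]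
    (G : SimpleGraph V) [DecidableRel G.Adj]
    (pos : V → ℂ)
    (him : Function.Injective fun v => (pos v).im)
    (hvert : ∀ a b u : V, G.Adj a b → u ≠ a → u ≠ b →
      pos u ∉ segment ℝ (pos a) (pos b))
    (hcross : ∀ a b c d : V, G.Adj a b → G.Adj c d → (s(a, b) : Sym2 V) ≠ s(c, d) →
      ∀ z ∈ segment ℝ (pos a) (pos b) ∩ segment ℝ (pos c) (pos d),
        ∃ u : V, (u = a ∨ u = b) ∧ (u = c ∨ u = d) ∧ z = pos u)
    (M : Matrix {p : V × V // G.Adj p.1 p.2} {p : V × V // G.Adj p.1 p.2}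
      (MvPolynomial G.edgeSet ℂ))
    (hM : ∀ e e' : {p : V × V // G.Adj p.1 p.2},
      M e e' =
        if e' = e then 1
        else if e'.1.1 = e.1.2 ∧ e'.1 ≠ (e.1.2, e.1.1) then
          - (MvPolynomial.C (Complex.exp (Complex.I / 2 *
              (Complex.arg ((pos e'.1.2 - pos e'.1.1) / (pos e.1.2 - pos e.1.1)) : ℂ))) *
            MvPolynomial.X ⟨s(e.1.1, e.1.2), G.mem_edgeSet.mpr e.2⟩)
        else 0) :
    M.det =
      (∑ ξ ∈ Finset.univ.filter
          (fun ξ : Finset G.edgeSet =>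
            ∀ v : V, Even ((ξ.filter (fun f : G.edgeSet => v ∈ (f : Sym2 V))).card)),
        ∏ f ∈ ξ, MvPolynomial.X f) ^ 2 := by
  classical
  have hinj : Function.Injective pos := fun u v h => him (congrArg Complex.im h)
  obtain ⟨hord, hlt⟩ := exists_dart_order him hvert
  have hle : ∀ {a b : {p : V × V // G.Adj p.1 p.2}}, a < b → (pos b.1.2).im ≤ (pos a.1.2).im := by
    intro a b hab
    rcases (hlt a b).1 hab with h | h
    · exact h.le
    · rw [h.1]
  apply MvPolynomial.expand_injective (n := 2) two_pos
  let N : Matrix {p : V × V // G.Adj p.1 p.2} {p : V × V // G.Adj p.1 p.2}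
      (MvPolynomial G.edgeSet ℂ) := (MvPolynomial.expand 2).mapMatrix M
  have hdet := det_eq_pfSum_sq (MvPolynomial.constantCoeff (R := ℂ) (σ := G.edgeSet))
    (dartRev_involutive G) (dartRev_ne G) (vert := fun h => h.1.2)
    (z := fun e => MvPolynomial.X (dartEdge G e))
    (ω := fun e => MvPolynomial.C (Complex.exp (Complex.I / 2 * (pos e.1.2 - pos e.1.1).arg)))
    (τ := fun e e' => MvPolynomial.C (Complex.exp (Complex.I / 2 *
      ((pos e'.1.2 - pos e'.1.1) / (pos e.1.2 - pos e.1.1)).arg))) (N := N)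
    ?_ ?_ ?_ ?_ ?_ ?_ ?_
  · have hsum := sum_even_darts G (fun f => (MvPolynomial.X f : MvPolynomial G.edgeSet ℂ))
      (D := Finset.univ.filter fun U =>
        (∀ h ∈ U, dartRev G h ∈ U) ∧ EvenAt (fun h => h.1.2) U) (fun U => by simp)
    rw [pfSum_univ (dartRev_involutive G) (dartRev_ne G) _
      (fun U hU heven => crossingSign_eq_one _ him hvert hcross (dartRev_involutive G)
        (dartRev_ne G) (head := fun h => h.1.2) (tail := fun h => h.1.1) (fun _ => rfl)
        (fun h => h.2.symm) (fun e f h1 h2 => Subtype.ext (Prod.ext h2 h1)) hlt hU heven)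
      (D := Finset.univ.filter fun U =>
        (∀ h ∈ U, dartRev G h ∈ U) ∧ EvenAt (fun h => h.1.2) U) (fun U => by simp), hsum,
      mul_pow, pow_two (crossingSign _ _ _), crossingSign_mul_self, one_mul] at hdet
    simp only [AlgHom.map_det, map_pow, map_sum, map_prod, MvPolynomial.expand_X]
    rw [← hdet]
    congr!
  · intro a b h hah hhb hab
    have h1 := hle hah
    have h2 := hle hhb
    rw [← show a.1.2 = b.1.2 from hab] at h2
    exact him (le_antisymm h1 h2)
  · exact fun h => h.2.ne
  · intro h
    simp
  · intro h
    simp only [dartEdge_rev]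
  · intro h
    simp [Complex.exp_ne_zero]
  · rintro ⟨⟨a, h⟩, ha⟩ ⟨⟨h', b⟩, hb⟩ heq hne
    obtain rfl : h' = h := heq
    have hab : a ≠ b := fun hab => hne (by subst hab; rfl)
    have hp : (pos a - pos h').im ≠ 0 := by
      rw [Complex.sub_im, sub_ne_zero]
      exact him.ne ha.ne
    have harg := arg_sub_ne_of_drawing hinj hvert ha.symm hb hab
    have key := exp_half_arg_div_neg hp (sub_ne_zero.2 (hinj.ne hb.ne')) harg
    rw [neg_sub] at key
    have h1 : -ordSign (MvPolynomial G.edgeSet ℂ) ⟨(a, h'), ha⟩ (dartRev G ⟨(a, h'), ha⟩) =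
        MvPolynomial.C (if (pos a - pos h').im < 0 then -1 else 1) := by
      have : dartRev G ⟨(a, h'), ha⟩ < ⟨(a, h'), ha⟩ ↔ ¬ (pos a - pos h').im < 0 := by
        rw [hlt, DartLT, Complex.sub_im, sub_neg, not_lt]
        simp only [dartRev]
        rw [hinj.eq_iff, or_iff_left (fun h => ha.ne h.1)]
        exact ⟨le_of_lt, fun h => lt_of_le_of_ne h (him.ne ha.ne')⟩
      rw [ordSign]
      simp only [this]
      split_ifs <;> simp
    have h2 : ordSign (MvPolynomial G.edgeSet ℂ) ⟨(a, h'), ha⟩ (dartRev G ⟨(h', b), hb⟩) =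
        MvPolynomial.C (if (pos b - pos h').arg < (pos a - pos h').arg then 1 else -1) := by
      have : dartRev G ⟨(h', b), hb⟩ < ⟨(a, h'), ha⟩ ↔
          ¬ (pos b - pos h').arg < (pos a - pos h').arg := by
        rw [hlt, DartLT, not_lt]
        simp only [dartRev, lt_irrefl, true_and, false_or]
        exact ⟨le_of_lt, fun h => lt_of_le_of_ne h harg⟩
      rw [ordSign]
      simp only [this]
      split_ifs <;> simp
    rw [h1, h2, ← map_mul, ← map_mul, ← map_mul, key]
  · intro e e'
    change MvPolynomial.expand 2 (M e e') = _
    have hiff : e'.1 ≠ (e.1.2, e.1.1) ↔ e' ≠ dartRev G e := by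
      rw [Ne, Ne, Subtype.ext_iff]
      rfl
    rw [hM]
    simp only [hiff]
    have hiff' : (dartRev G e').1.2 = e'.1.1 := rfl
    rw [hiff']
    split_ifs
    · simp
    · simp only [map_neg, map_mul, MvPolynomial.expand_C, MvPolynomial.expand_X]
      rfl
    · simp

theorem kac_ward_formula_planar
    {V : Type*} [Fintype V] [DecidableEq V]
    (G : SimpleGraph V) [DecidableRel G.Adj]
    (pos : V → ℂ)
    -- `pos` is a straight-line planar drawing of `G`:
    (hinj : Function.Injective pos)
    (hvert : ∀ a b u : V, G.Adj a b → u ≠ a → u ≠ b →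
      pos u ∉ segment ℝ (pos a) (pos b))
    (hcross : ∀ a b c d : V, G.Adj a b → G.Adj c d → (s(a, b) : Sym2 V) ≠ s(c, d) →
      ∀ z ∈ segment ℝ (pos a) (pos b) ∩ segment ℝ (pos c) (pos d),
        ∃ u : V, (u = a ∨ u = b) ∧ (u = c ∨ u = d) ∧ z = pos u)
    -- the Kac-Ward matrix, indexed by oriented edges:
    (M : Matrix {p : V × V // G.Adj p.1 p.2} {p : V × V // G.Adj p.1 p.2}
      (MvPolynomial G.edgeSet ℂ))
    (hM : ∀ e e' : {p : V × V // G.Adj p.1 p.2},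
      M e e' =
        if e' = e then 1
        else if e'.1.1 = e.1.2 ∧ e'.1 ≠ (e.1.2, e.1.1) then
          - (MvPolynomial.C (Complex.exp (Complex.I / 2 *
              (Complex.arg ((pos e'.1.2 - pos e'.1.1) / (pos e.1.2 - pos e.1.1)) : ℂ))) *
            MvPolynomial.X ⟨s(e.1.1, e.1.2), G.mem_edgeSet.mpr e.2⟩)
        else 0) :
    M.det =
      (∑ ξ ∈ Finset.univ.filter
          (fun ξ : Finset G.edgeSet =>
            ∀ v : V, Even ((ξ.filter (fun f : G.edgeSet => v ∈ (f : Sym2 V))).card)),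
        ∏ f ∈ ξ, MvPolynomial.X f) ^ 2 := by
  obtain ⟨c, hc, him⟩ := exists_mul_im_injective hinj
  refine kac_ward_formula_of_injective_im G (fun v => c * pos v) him ?_ ?_ M ?_
  · intro a b u hab hua hub hu
    apply hvert a b u hab hua hub
    simpa [inv_mul_cancel_left₀ hc] using mem_segment_of_mul_mem_segment hc hu
  · intro a b d e hab hde hne z hz
    obtain ⟨u, h1, h2, h3⟩ := hcross a b d e hab hde hne (c⁻¹ * z)
      ⟨mem_segment_of_mul_mem_segment hc hz.1, mem_segment_of_mul_mem_segment hc hz.2⟩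
    exact ⟨u, h1, h2, by rw [← h3, mul_inv_cancel_left₀ hc]⟩
  · intro e e'
    simp only [← mul_sub, mul_div_mul_left _ _ hc]
    exact hM e e'
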